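/- Suppose z* is a solution at which MFCQ, the second-order condition and strict complementarity are satisfied, fix centrality constants C > 0, γ ∈ (0,1), and suppose the correction vector satisfies ‖t‖ ≤ K_t μ². Then there exist K > 0, μ̄ > 0 and a neighborhood W of S such that for every iterate (z,λ,s) satisfying the approximate centrality conditions with (z,λ) ∈ W and μ = λᵀs/m ≤ μ̄, the exact primal–dual step satisfies ‖(Δz, Δλ, Δs)‖ ≤ K·μ. -/

import Mathlib

open Matrix
open scoped BigOperators

noncomputable section

attribute [local instance] Classical.propDecidable

/-- Euclidean norm of a finitely indexed family of real numbers. -/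
def evnorm {ι : Type*} [Fintype ι] (v : ι → ℝ) : ℝ :=
  Real.sqrt (∑ i, v i ^ 2)

/-- Frobenius norm of a real matrix. -/
def mnorm {ι κ : Type*} [Fintype ι] [Fintype κ] (M : Matrix ι κ ℝ) : ℝ :=
  Real.sqrt (∑ i, ∑ j, M i j ^ 2)

/-- Smallest singular value of a real matrix. -/
def sigmaMin {ι κ : Type*} [Fintype ι] [Fintype κ] (M : Matrix ι κ ℝ) : ℝ :=
  sInf {t | ∃ x : κ → ℝ, evnorm x = 1 ∧ t = evnorm (M.mulVec x)}

/-- The continuous linear functional `x ↦ ⟨v, x⟩` on `ℝⁿ`. -/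
def dotCLM {n : ℕ} (v : Fin n → ℝ) : (Fin n → ℝ) →L[ℝ] ℝ :=
  ∑ i, v i • (ContinuousLinearMap.proj (R := ℝ) (φ := fun _ : Fin n => ℝ) i)

/-- The continuous linear map `x ↦ M x` on `ℝⁿ`. -/
def matCLM {n : ℕ} (M : Matrix (Fin n) (Fin n) ℝ) : (Fin n → ℝ) →L[ℝ] (Fin n → ℝ) :=
  LinearMap.toContinuousLinearMap (Matrix.toLin' M)

/-- Duality measure `μ(λ,s) = λᵀ s / m`. -/
def dmu {m : ℕ} (lam s : Fin m → ℝ) : ℝ := (∑ i, lam i * s i) / (m : ℝ)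

/-- Data of the nonlinear program `min φ(z)  s.t.  g(z) ≤ 0`, with `φ` and each `gᵢ`
twice Lipschitz continuously differentiable; `gradphi`, `gradg` are the gradients and
`hessphi`, `hessg` the (symmetric) Hessians. -/
structure NLP (n m : ℕ) where
  phi : (Fin n → ℝ) → ℝ
  g : Fin m → (Fin n → ℝ) → ℝ
  gradphi : (Fin n → ℝ) → Fin n → ℝ
  gradg : Fin m → (Fin n → ℝ) → Fin n → ℝ
  hessphi : (Fin n → ℝ) → Matrix (Fin n) (Fin n) ℝ
  hessg : Fin m → (Fin n → ℝ) → Matrix (Fin n) (Fin n) ℝ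
  grad_phi : ∀ z, HasFDerivAt phi (dotCLM (gradphi z)) z
  grad_g : ∀ i z, HasFDerivAt (g i) (dotCLM (gradg i z)) z
  hess_phi : ∀ z, HasFDerivAt gradphi (matCLM (hessphi z)) z
  hess_g : ∀ i z, HasFDerivAt (gradg i) (matCLM (hessg i z)) z
  hessphi_symm : ∀ z, (hessphi z).IsSymm
  hessg_symm : ∀ i z, (hessg i z).IsSymm
  lip_phi : ∃ K, ∀ z z', mnorm (hessphi z - hessphi z') ≤ K * evnorm (z - z')
  lip_g : ∀ i, ∃ K, ∀ z z', mnorm (hessg i z - hessg i z') ≤ K * evnorm (z - z')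

namespace NLP

variable {n m : ℕ} (P : NLP n m)

/-- Gradient of the Lagrangian with respect to `z`:  `L_z(z,λ) = ∇φ(z) + ∇g(z)λ`. -/
def Lz (z : Fin n → ℝ) (lam : Fin m → ℝ) : Fin n → ℝ :=
  fun j => P.gradphi z j + ∑ i, lam i * P.gradg i z j

/-- Hessian of the Lagrangian with respect to `z`. -/
def Lzz (z : Fin n → ℝ) (lam : Fin m → ℝ) : Matrix (Fin n) (Fin n) ℝ :=
  P.hessphi z + ∑ i, lam i • P.hessg i z

/-- The KKT conditions at `(z, λ)`. -/
def KKT (z : Fin n → ℝ) (lam : Fin m → ℝ) : Prop :=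
  P.Lz z lam = 0 ∧ (∀ i, P.g i z ≤ 0) ∧ (∀ i, 0 ≤ lam i) ∧ (∑ i, lam i * P.g i z) = 0

/-- The set `S_λ` of optimal Lagrange multipliers at `z*`. -/
def Slam (zstar : Fin n → ℝ) : Set (Fin m → ℝ) := {lam | P.KKT zstar lam}

/-- The Mangasarian–Fromovitz constraint qualification at `z*`. -/
def MFCQ (zstar : Fin n → ℝ) : Prop :=
  ∃ ybar : Fin n → ℝ, ∀ i, P.g i zstar = 0 → (∑ j, P.gradg i zstar j * ybar j) < 0

/-- The index set `B₊` of active constraints with a positive multiplier. -/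
def BPlus (zstar : Fin n → ℝ) : Set (Fin m) :=
  {i | P.g i zstar = 0 ∧ ∃ ls ∈ P.Slam zstar, 0 < ls i}

/-- The second-order sufficient condition at `z*`. -/
def SOC (zstar : Fin n → ℝ) : Prop :=
  ∃ ξ : ℝ, 0 < ξ ∧ ∀ ls ∈ P.Slam zstar, ∀ w : Fin n → ℝ,
    (∀ i, i ∈ P.BPlus zstar → (∑ j, P.gradg i zstar j * w j) = 0) →
    (∀ i, P.g i zstar = 0 → i ∉ P.BPlus zstar → (∑ j, P.gradg i zstar j * w j) ≤ 0) →
    ξ * evnorm w ^ 2 ≤ w ⬝ᵥ (P.Lzz zstar ls).mulVec w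

/-- The strict complementarity condition `B₊ = B` at `z*`. -/
def StrictComp (zstar : Fin n → ℝ) : Prop :=
  ∀ i, P.g i zstar = 0 → i ∈ P.BPlus zstar

/-- `z*` is a solution of the nonlinear program: it is feasible, it is a local
minimizer, and the first-order KKT conditions hold there. -/
def isSolution (zstar : Fin n → ℝ) : Prop :=
  (∀ i, P.g i zstar ≤ 0) ∧ (∃ lam, P.KKT zstar lam) ∧
  ∀ᶠ z in nhds zstar, (∀ i, P.g i z ≤ 0) → P.phi zstar ≤ P.phi z

/-- Euclidean distance `δ(z,λ)` from `(z,λ)` to the primal–dual solution set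
`S = {z*} × S_λ`. -/
def delta (zstar z : Fin n → ℝ) (lam : Fin m → ℝ) : ℝ :=
  sInf {d | ∃ ls ∈ P.Slam zstar,
    d = Real.sqrt (evnorm (z - zstar) ^ 2 + evnorm (lam - ls) ^ 2)}

/-- The approximate centrality conditions with constants `C`, `γ`. -/
def central (C gam : ℝ) (z : Fin n → ℝ) (lam s : Fin m → ℝ) : Prop :=
  evnorm (P.Lz z lam) ≤ C * dmu lam s ∧
  evnorm (fun i => P.g i z + s i) ≤ C * dmu lam s ∧
  (∀ i, 0 < lam i) ∧ (∀ i, 0 < s i) ∧ (∀ i, gam * dmu lam s ≤ lam i * s i)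

/-- The active index set `B` at `z*`, as a type. -/
abbrev Bsub (zstar : Fin n → ℝ) : Type := {i : Fin m // P.g i zstar = 0}

/-- The inactive index set `N` at `z*`, as a type. -/
abbrev Nsub (zstar : Fin n → ℝ) : Type := {i : Fin m // ¬ P.g i zstar = 0}

/-- `∇g(z)`:  the `n × m` matrix whose columns are the constraint gradients. -/
def Gfull (z : Fin n → ℝ) : Matrix (Fin n) (Fin m) ℝ :=
  Matrix.of fun j i => P.gradg i z j

/-- `∇g_B(z)`:  the columns of `∇g(z)` indexed by the active set `B` at `z*`. -/
def GB (zstar z : Fin n → ℝ) : Matrix (Fin n) (P.Bsub zstar) ℝ :=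
  Matrix.of fun j b => P.gradg b.1 z j

/-- `∇g_N(z)`:  the columns of `∇g(z)` indexed by the inactive set `N` at `z*`. -/
def GN (zstar z : Fin n → ℝ) : Matrix (Fin n) (P.Nsub zstar) ℝ :=
  Matrix.of fun j b => P.gradg b.1 z j

/-- The diagonal matrix `D_B = Λ_B⁻¹ S_B`. -/
def DB (zstar : Fin n → ℝ) (lam s : Fin m → ℝ) :
    Matrix (P.Bsub zstar) (P.Bsub zstar) ℝ :=
  Matrix.diagonal fun b => s b.1 / lam b.1

/-- The diagonal matrix `D_N = Λ_N⁻¹ S_N`. -/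
def DN (zstar : Fin n → ℝ) (lam s : Fin m → ℝ) :
    Matrix (P.Nsub zstar) (P.Nsub zstar) ℝ :=
  Matrix.diagonal fun b => s b.1 / lam b.1

/-- The exact primal–dual step: the solution of the linear system (pdip.orig). -/
def exactStep (z : Fin n → ℝ) (lam s t : Fin m → ℝ) (dz : Fin n → ℝ)
    (dl ds : Fin m → ℝ) : Prop :=
  (∀ j, ((P.Lzz z lam).mulVec dz) j + ((P.Gfull z).mulVec dl) j = -(P.Lz z lam j)) ∧
  (∀ i, (((P.Gfull z)ᵀ).mulVec dz) i + ds i = -(P.g i z + s i)) ∧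
  (∀ i, s i * dl i + lam i * ds i = -(s i * lam i + t i))

end NLP

/-- Part (a) of Assumption A: `z*` is a solution at which MFCQ, the second-order
condition, and strict complementarity hold, and the current iterate `(z,λ,s)`
satisfies the approximate centrality conditions with constants `C`, `γ`. -/
def AssumptionAa {n m : ℕ} (P : NLP n m) (zstar : Fin n → ℝ) (C gam : ℝ)
    (z : Fin n → ℝ) (lam s : Fin m → ℝ) : Prop :=
  P.isSolution zstar ∧ P.MFCQ zstar ∧ P.SOC zstar ∧ P.StrictComp zstar ∧
  P.central C gam z lam s

/-- The data of a singular value decomposition `∇g_B(z*) = Û Σ Uᵀ`, where the square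
matrices `[Û V̂]` (of order `n`) and `[U V]` (of order `|B|`) are orthogonal and `Σ` is
diagonal with positive diagonal entries. -/
structure SVDdata {n m : ℕ} (P : NLP n m) (zstar : Fin n → ℝ) where
  k : ℕ
  kc : ℕ
  r : ℕ
  Uhat : Matrix (Fin n) (Fin k) ℝ
  Vhat : Matrix (Fin n) (Fin kc) ℝ
  U : Matrix (P.Bsub zstar) (Fin k) ℝ
  V : Matrix (P.Bsub zstar) (Fin r) ℝ
  sig : Fin k → ℝ
  sig_pos : ∀ j, 0 < sig j
  hUhat : Uhatᵀ * Uhat = 1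
  hVhat : Vhatᵀ * Vhat = 1
  hUVhat : Uhatᵀ * Vhat = 0
  hhat_complete : Uhat * Uhatᵀ + Vhat * Vhatᵀ = 1
  hU : Uᵀ * U = 1
  hV : Vᵀ * V = 1
  hUV : Uᵀ * V = 0
  h_complete : U * Uᵀ + V * Vᵀ = 1
  hsvd : P.GB zstar zstar = Uhat * Matrix.diagonal sig * Uᵀ

section

open Filter Topology Asymptotics

theorem evnorm_nonneg {ι : Type*} [Fintype ι] (v : ι → ℝ) : 0 ≤ evnorm v :=
  Real.sqrt_nonneg _

theorem abs_le_evnorm {ι : Type*} [Fintype ι] (v : ι → ℝ) (i : ι) : |v i| ≤ evnorm v := by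
  rw [evnorm, ← Real.sqrt_sq_eq_abs]
  exact Real.sqrt_le_sqrt
    (Finset.single_le_sum (f := fun i => v i ^ 2) (fun j _ => sq_nonneg (v j)) (Finset.mem_univ i))

theorem norm_le_evnorm {ι : Type*} [Fintype ι] (v : ι → ℝ) : ‖v‖ ≤ evnorm v :=
  (pi_norm_le_iff_of_nonneg (evnorm_nonneg v)).2 fun i => abs_le_evnorm v i

theorem abs_apply_le_norm {ι : Type*} [Fintype ι] (v : ι → ℝ) (i : ι) : |v i| ≤ ‖v‖ :=
  norm_le_pi_norm v i

theorem evnorm_le_card_mul_norm {ι : Type*} [Fintype ι] (v : ι → ℝ) :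
    evnorm v ≤ Fintype.card ι * ‖v‖ := by
  refine Real.sqrt_le_iff.2 ⟨by positivity, ?_⟩
  calc ∑ i, v i ^ 2 ≤ ∑ _i : ι, ‖v‖ ^ 2 := by
        refine Finset.sum_le_sum fun i _ => ?_
        rw [← sq_abs]
        exact pow_le_pow_left₀ (abs_nonneg _) (abs_apply_le_norm v i) 2
    _ = Fintype.card ι * ‖v‖ ^ 2 := by simp
    _ ≤ (Fintype.card ι * ‖v‖) ^ 2 := by
        rw [mul_pow]
        gcongr
        exact_mod_cast Nat.le_self_pow two_ne_zero _

theorem abs_entry_le_mnorm {ι κ : Type*} [Fintype ι] [Fintype κ] (M : Matrix ι κ ℝ)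
    (i : ι) (j : κ) : |M i j| ≤ mnorm M := by
  rw [mnorm, ← Real.sqrt_sq_eq_abs]
  refine Real.sqrt_le_sqrt ((Finset.single_le_sum (f := fun j => M i j ^ 2)
    (fun j _ => sq_nonneg _) (Finset.mem_univ j)).trans ?_)
  exact Finset.single_le_sum (f := fun i => ∑ j, M i j ^ 2)
    (fun i _ => Finset.sum_nonneg fun j _ => sq_nonneg _) (Finset.mem_univ i)

theorem abs_dotProduct_le {ι : Type*} [Fintype ι] (v w : ι → ℝ) :
    |v ⬝ᵥ w| ≤ Fintype.card ι * (‖v‖ * ‖w‖) := by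
  calc |v ⬝ᵥ w| ≤ ∑ i, |v i * w i| := Finset.abs_sum_le_sum_abs _ _
    _ ≤ ∑ _i : ι, ‖v‖ * ‖w‖ := by
        refine Finset.sum_le_sum fun i _ => ?_
        rw [abs_mul]
        gcongr <;> exact abs_apply_le_norm _ i
    _ = Fintype.card ι * (‖v‖ * ‖w‖) := by simp

theorem norm_sq_le_sum_sq {ι : Type*} [Fintype ι] (v : ι → ℝ) : ‖v‖ ^ 2 ≤ ∑ i, v i ^ 2 := by
  have h := pow_le_pow_left₀ (norm_nonneg v) (norm_le_evnorm v) 2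
  rwa [evnorm, Real.sq_sqrt (Finset.sum_nonneg fun i _ => sq_nonneg _)] at h

/-- The sum of the absolute values of the entries of a real matrix. -/
def entrySum {ι κ : Type*} [Fintype ι] [Fintype κ] (M : Matrix ι κ ℝ) : ℝ :=
  ∑ i, ∑ j, |M i j|

theorem entrySum_nonneg {ι κ : Type*} [Fintype ι] [Fintype κ] (M : Matrix ι κ ℝ) :
    0 ≤ entrySum M :=
  Finset.sum_nonneg fun _ _ => Finset.sum_nonneg fun _ _ => abs_nonneg _

theorem norm_mulVec_le {ι κ : Type*} [Fintype ι] [Fintype κ] (M : Matrix ι κ ℝ) (v : κ → ℝ) :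
    ‖M *ᵥ v‖ ≤ entrySum M * ‖v‖ := by
  refine (pi_norm_le_iff_of_nonneg (mul_nonneg (entrySum_nonneg M) (norm_nonneg v))).2 fun i => ?_
  calc |∑ j, M i j * v j| ≤ ∑ j, |M i j * v j| := Finset.abs_sum_le_sum_abs _ _
    _ ≤ ∑ j, |M i j| * ‖v‖ := by
        refine Finset.sum_le_sum fun j _ => ?_
        rw [abs_mul]
        gcongr
        exact abs_apply_le_norm _ j
    _ = (∑ j, |M i j|) * ‖v‖ := by rw [Finset.sum_mul]
    _ ≤ entrySum M * ‖v‖ := by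
        gcongr
        exact Finset.single_le_sum (f := fun i => ∑ j, |M i j|)
          (fun i _ => Finset.sum_nonneg fun j _ => abs_nonneg _) (Finset.mem_univ i)

theorem abs_quadForm_le {ι : Type*} [Fintype ι] (M : Matrix ι ι ℝ) (v w : ι → ℝ) :
    |v ⬝ᵥ M *ᵥ w| ≤ Fintype.card ι * entrySum M * (‖v‖ * ‖w‖) := by
  calc |v ⬝ᵥ M *ᵥ w| ≤ Fintype.card ι * (‖v‖ * ‖M *ᵥ w‖) := abs_dotProduct_le _ _
    _ ≤ Fintype.card ι * (‖v‖ * (entrySum M * ‖w‖)) := by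
        gcongr
        exact norm_mulVec_le M w
    _ = _ := by ring

/-- Every vector in the range of a matrix has a preimage of comparable size. -/
theorem exists_mulVec_eq_norm_le {ι κ : Type*} [Fintype ι] [Fintype κ] (A : Matrix ι κ ℝ) :
    ∃ c : ℝ, 0 < c ∧ ∀ x, ∃ y, A *ᵥ y = A *ᵥ x ∧ ‖y‖ ≤ c * ‖A *ᵥ x‖ := by
  obtain ⟨f, hf⟩ := LinearMap.exists_rightInverse_of_surjective
    (A.mulVecLin.rangeRestrict) (LinearMap.range_rangeRestrict _)
  obtain ⟨c, hc, h⟩ := (LinearMap.toContinuousLinearMap f).bound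
  refine ⟨c, hc, fun x => ⟨f (A.mulVecLin.rangeRestrict x), ?_, ?_⟩⟩
  · exact congrArg Subtype.val (LinearMap.congr_fun hf (A.mulVecLin.rangeRestrict x))
  · exact h (A.mulVecLin.rangeRestrict x)

/-- A quadratic form that is positive definite on the kernel of `A` becomes positive definite
everywhere once a large multiple of `‖A w‖²` is added. -/
theorem exists_quadForm_lower_bound {n m : ℕ} (H : Matrix (Fin n) (Fin n) ℝ)
    (A : Matrix (Fin m) (Fin n) ℝ) {ξ : ℝ} (hξ : 0 < ξ)
    (h : ∀ w, A *ᵥ w = 0 → ξ * evnorm w ^ 2 ≤ w ⬝ᵥ H *ᵥ w) :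
    ∃ ξ' κ : ℝ, 0 < ξ' ∧ 0 < κ ∧
      ∀ w, ξ' * ‖w‖ ^ 2 ≤ w ⬝ᵥ H *ᵥ w + κ * ‖A *ᵥ w‖ ^ 2 := by
  obtain ⟨c, hc, hA⟩ := exists_mulVec_eq_norm_le A
  set N : ℝ := n * entrySum H with hN
  have hN0 : 0 ≤ N := mul_nonneg (Nat.cast_nonneg _) (entrySum_nonneg H)
  refine ⟨ξ / 4, (2 * N ^ 2 / ξ + N + ξ / 2) * c ^ 2, by positivity, by positivity, fun w => ?_⟩
  obtain ⟨y, hy, hyn⟩ := hA w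
  set k := w - y with hk
  have hw : w = k + y := by simp [hk]
  have hker : A *ᵥ k = 0 := by rw [hk, Matrix.mulVec_sub, hy, sub_self]
  have h1 : ξ * ‖k‖ ^ 2 ≤ k ⬝ᵥ H *ᵥ k := by
    refine le_trans ?_ (h k hker)
    gcongr
    exact norm_le_evnorm k
  have h2 : |k ⬝ᵥ H *ᵥ y| ≤ N * (‖k‖ * ‖y‖) := by simpa [hN] using abs_quadForm_le H k y
  have h3 : |y ⬝ᵥ H *ᵥ k| ≤ N * (‖y‖ * ‖k‖) := by simpa [hN] using abs_quadForm_le H y k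
  have h4 : |y ⬝ᵥ H *ᵥ y| ≤ N * (‖y‖ * ‖y‖) := by simpa [hN] using abs_quadForm_le H y y
  have h5 : w ⬝ᵥ H *ᵥ w
      = k ⬝ᵥ H *ᵥ k + k ⬝ᵥ H *ᵥ y + y ⬝ᵥ H *ᵥ k + y ⬝ᵥ H *ᵥ y := by
    rw [hw]
    simp only [Matrix.mulVec_add, dotProduct_add, add_dotProduct]
    ring
  have h6 : ‖w‖ ≤ ‖k‖ + ‖y‖ := by rw [hw]; exact norm_add_le _ _
  have h7 : ‖y‖ ^ 2 ≤ c ^ 2 * ‖A *ᵥ w‖ ^ 2 := by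
    rw [← mul_pow]
    exact pow_le_pow_left₀ (norm_nonneg _) hyn 2
  have h8 : ‖w‖ ^ 2 ≤ 2 * ‖k‖ ^ 2 + 2 * ‖y‖ ^ 2 := by
    nlinarith [sq_nonneg (‖k‖ - ‖y‖), norm_nonneg w, norm_nonneg k, norm_nonneg y]
  have h9 : 2 * N * (‖k‖ * ‖y‖) ≤ ξ / 2 * ‖k‖ ^ 2 + 2 * N ^ 2 / ξ * ‖y‖ ^ 2 := by
    have : ξ / 2 * ‖k‖ ^ 2 + 2 * N ^ 2 / ξ * ‖y‖ ^ 2 - 2 * N * (‖k‖ * ‖y‖)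
        = (ξ * ‖k‖ - 2 * N * ‖y‖) ^ 2 / (2 * ξ) := by
      field_simp
      ring
    have h0 : 0 ≤ (ξ * ‖k‖ - 2 * N * ‖y‖) ^ 2 / (2 * ξ) := by positivity
    linarith
  have h10 : (2 * N ^ 2 / ξ + N + ξ / 2) * ‖y‖ ^ 2
      ≤ (2 * N ^ 2 / ξ + N + ξ / 2) * (c ^ 2 * ‖A *ᵥ w‖ ^ 2) := by gcongr
  have h11 := neg_abs_le (k ⬝ᵥ H *ᵥ y)
  have h12 := neg_abs_le (y ⬝ᵥ H *ᵥ k)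
  have h13 := neg_abs_le (y ⬝ᵥ H *ᵥ y)
  nlinarith [norm_nonneg w]

theorem dotCLM_apply {n : ℕ} (v x : Fin n → ℝ) : dotCLM v x = v ⬝ᵥ x := by
  simp [dotCLM, dotProduct]

theorem matCLM_apply {n : ℕ} (M : Matrix (Fin n) (Fin n) ℝ) (x : Fin n → ℝ) :
    matCLM M x = M *ᵥ x := by
  simp [matCLM]

theorem hasFDerivAt_quadForm {n : ℕ} {H : Matrix (Fin n) (Fin n) ℝ} (hH : H.IsSymm)
    (a y : Fin n → ℝ) :
    HasFDerivAt (fun y => 1 / 2 * ((y - a) ⬝ᵥ H *ᵥ (y - a))) (dotCLM (H *ᵥ (y - a))) y := by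
  have hd : HasFDerivAt (fun y : Fin n → ℝ => y - a) (ContinuousLinearMap.id ℝ (Fin n → ℝ)) y :=
    (hasFDerivAt_id y).sub_const a
  have hM : HasFDerivAt (fun y : Fin n → ℝ => matCLM H (y - a)) (matCLM H) y := by
    simpa using (matCLM H).hasFDerivAt.comp y hd
  have h := HasFDerivAt.fun_sum (u := Finset.univ) fun i _ =>
    ((hasFDerivAt_pi'.1 hd) i).mul ((hasFDerivAt_pi'.1 hM) i)
  have h' := h.const_mul (1 / 2 : ℝ)
  simp only [matCLM_apply] at h'
  refine h'.congr_fderiv ?_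
  ext x
  have hsym : (y - a) ⬝ᵥ H *ᵥ x = (H *ᵥ (y - a)) ⬝ᵥ x := by
    rw [Matrix.dotProduct_mulVec, ← Matrix.mulVec_transpose, hH.eq]
  rw [dotCLM_apply]
  have : ∑ i, ((y - a) i * (H *ᵥ x) i + (H *ᵥ (y - a)) i * x i)
      = 2 * ((H *ᵥ (y - a)) ⬝ᵥ x) := by
    rw [Finset.sum_add_distrib, two_mul]
    congr 1
  simp only [_root_.smul_apply, _root_.sum_apply, _root_.add_apply,
    ContinuousLinearMap.comp_apply, ContinuousLinearMap.proj_apply, ContinuousLinearMap.id_apply,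
    matCLM_apply, smul_eq_mul]
  rw [this]
  ring

/-- Second-order Taylor expansion with Peano remainder. -/
theorem taylor_two_isLittleO {n : ℕ} {f : (Fin n → ℝ) → ℝ} {gf : (Fin n → ℝ) → Fin n → ℝ}
    {H : Matrix (Fin n) (Fin n) ℝ} {a : Fin n → ℝ} (hH : H.IsSymm)
    (hf : ∀ z, HasFDerivAt f (dotCLM (gf z)) z) (hgf : HasFDerivAt gf (matCLM H) a) :
    (fun z => f z - f a - gf a ⬝ᵥ (z - a) - 1 / 2 * ((z - a) ⬝ᵥ H *ᵥ (z - a)))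
      =o[𝓝 a] fun z => ‖z - a‖ ^ 2 := by
  refine isLittleO_iff.2 fun ε hε => ?_
  have hn : (0 : ℝ) < n + 1 := by positivity
  have h1 := isLittleO_iff.1 hgf.isLittleO (div_pos hε hn)
  obtain ⟨δ, hδ, hball⟩ := Metric.eventually_nhds_iff.1 h1
  refine Metric.eventually_nhds_iff.2 ⟨δ, hδ, fun z hz => ?_⟩
  let F : (Fin n → ℝ) → ℝ :=
    fun y => f y - gf a ⬝ᵥ (y - a) - 1 / 2 * ((y - a) ⬝ᵥ H *ᵥ (y - a))
  have hF : ∀ y, HasFDerivAt F (dotCLM (gf y) - dotCLM (gf a) - dotCLM (H *ᵥ (y - a))) y := by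
    intro y
    have hlin : HasFDerivAt (fun y => gf a ⬝ᵥ (y - a)) (dotCLM (gf a)) y := by
      have := (dotCLM (gf a)).hasFDerivAt.comp y ((hasFDerivAt_id y).sub_const a)
      simpa [Function.comp_def, dotCLM_apply] using this
    exact ((hf y).sub hlin).sub (hasFDerivAt_quadForm hH a y)
  have hbound : ∀ y ∈ Metric.closedBall a (dist z a),
      ‖dotCLM (gf y) - dotCLM (gf a) - dotCLM (H *ᵥ (y - a))‖ ≤ ε * ‖z - a‖ := by
    intro y hy
    refine ContinuousLinearMap.opNorm_le_bound _ (by positivity) fun x => ?_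
    have e : (dotCLM (gf y) - dotCLM (gf a) - dotCLM (H *ᵥ (y - a))) x
        = (gf y - gf a - H *ᵥ (y - a)) ⬝ᵥ x := by
      simp [dotCLM_apply, sub_dotProduct]
    have hy' : ‖gf y - gf a - H *ᵥ (y - a)‖ ≤ ε / (n + 1) * ‖y - a‖ := by
      have := hball (lt_of_le_of_lt (Metric.mem_closedBall.1 hy) hz)
      rwa [matCLM_apply] at this
    have hyz : ‖y - a‖ ≤ ‖z - a‖ := by
      simpa [dist_eq_norm] using hy
    rw [e]
    calc ‖(gf y - gf a - H *ᵥ (y - a)) ⬝ᵥ x‖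
        ≤ n * (‖gf y - gf a - H *ᵥ (y - a)‖ * ‖x‖) := by
          simpa using abs_dotProduct_le (gf y - gf a - H *ᵥ (y - a)) x
      _ ≤ (n + 1) * (ε / (n + 1) * ‖z - a‖ * ‖x‖) := by
          gcongr
          · linarith
          · exact hy'.trans (by gcongr)
      _ = ε * ‖z - a‖ * ‖x‖ := by field_simp
  have hmv := (convex_closedBall a (dist z a)).norm_image_sub_le_of_norm_hasFDerivWithin_le
    (fun y _ => (hF y).hasFDerivWithinAt) hbound
    (Metric.mem_closedBall_self dist_nonneg) (Metric.mem_closedBall.2 le_rfl)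
  have e1 : F z - F a = f z - f a - gf a ⬝ᵥ (z - a) - 1 / 2 * ((z - a) ⬝ᵥ H *ᵥ (z - a)) := by
    simp only [F, sub_self, dotProduct_zero, Matrix.mulVec_zero]
    ring
  rw [e1] at hmv
  refine hmv.trans (le_of_eq ?_)
  rw [Real.norm_of_nonneg (by positivity)]
  ring

namespace NLP

variable {n m : ℕ} {P : NLP n m}

theorem Lz_eq (z : Fin n → ℝ) (lam : Fin m → ℝ) :
    P.Lz z lam = P.gradphi z + ∑ i, lam i • P.gradg i z := by
  ext j
  simp [Lz]

theorem Lzz_mulVec (z w : Fin n → ℝ) (lam : Fin m → ℝ) :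
    P.Lzz z lam *ᵥ w = P.hessphi z *ᵥ w + ∑ i, lam i • (P.hessg i z *ᵥ w) := by
  simp [Lzz, Matrix.add_mulVec, Matrix.sum_mulVec, Matrix.smul_mulVec]

theorem gradphi_isLittleO (zs : Fin n → ℝ) :
    (fun z => P.gradphi z - P.gradphi zs - P.hessphi zs *ᵥ (z - zs)) =o[𝓝 zs] fun z => z - zs := by
  simpa only [matCLM_apply] using (P.hess_phi zs).isLittleO

theorem gradg_isLittleO (i : Fin m) (zs : Fin n → ℝ) :
    (fun z => P.gradg i z - P.gradg i zs - P.hessg i zs *ᵥ (z - zs)) =o[𝓝 zs] fun z => z - zs := by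
  simpa only [matCLM_apply] using (P.hess_g i zs).isLittleO

theorem gradg_sub_isBigO (i : Fin m) (zs : Fin n → ℝ) :
    (fun z => P.gradg i z - P.gradg i zs) =O[𝓝 zs] fun z => z - zs :=
  (P.hess_g i zs).isBigO_sub

theorem KKT.multiplier_eq_zero {P : NLP n m} {z : Fin n → ℝ} {lam : Fin m → ℝ} (h : P.KKT z lam)
    {i : Fin m} (hi : P.g i z ≠ 0) : lam i = 0 := by
  obtain ⟨-, hg, hl, hsum⟩ := h
  have := (Finset.sum_eq_zero_iff_of_nonpos fun j _ =>
    mul_nonpos_of_nonneg_of_nonpos (hl j) (hg j)).1 hsum i (Finset.mem_univ i)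
  exact (mul_eq_zero.1 this).resolve_right hi

theorem central.mu_nonneg {P : NLP n m} {C gam : ℝ} {z : Fin n → ℝ} {lam s : Fin m → ℝ}
    (h : P.central C gam z lam s) : 0 ≤ dmu lam s :=
  div_nonneg (Finset.sum_nonneg fun i _ => (mul_pos (h.2.2.1 i) (h.2.2.2.1 i)).le)
    (Nat.cast_nonneg _)

end NLP

/-- A family of approximately central iterates converging along a filter to a primal-dual
solution. -/
structure LocalSetting {n m : ℕ} (P : NLP n m) (zs : Fin n → ℝ) (lh : Fin m → ℝ) (C gam : ℝ)
    {ι : Type*} (l : Filter ι) (z : ι → Fin n → ℝ) (lam s : ι → Fin m → ℝ) : Prop where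
  multiplier : lh ∈ P.Slam zs
  C_pos : 0 < C
  gam_pos : 0 < gam
  tendsto_z : Tendsto z l (𝓝 zs)
  tendsto_lam : Tendsto lam l (𝓝 lh)
  tendsto_mu : Tendsto (fun k => dmu (lam k) (s k)) l (𝓝 0)
  central : ∀ᶠ k in l, P.central C gam (z k) (lam k) (s k)

namespace LocalSetting

variable {n m : ℕ} {P : NLP n m} {zs : Fin n → ℝ} {lh : Fin m → ℝ} {C gam : ℝ}
  {ι : Type*} {l : Filter ι} {z : ι → Fin n → ℝ} {lam s : ι → Fin m → ℝ}

theorem mu_nonneg (h : LocalSetting P zs lh C gam l z lam s) :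
    ∀ᶠ k in l, 0 ≤ dmu (lam k) (s k) :=
  h.central.mono fun _ hk => hk.mu_nonneg

theorem mul_le (h : LocalSetting P zs lh C gam l z lam s) (i : Fin m) :
    ∀ᶠ k in l, lam k i * s k i ≤ m * dmu (lam k) (s k) := by
  filter_upwards [h.central] with k hk
  have hm : (m : ℝ) ≠ 0 := by
    have := i.pos
    positivity
  rw [dmu, mul_div_cancel₀ _ hm]
  exact Finset.single_le_sum (f := fun i => lam k i * s k i)
    (fun j _ => (mul_pos (hk.2.2.1 j) (hk.2.2.2.1 j)).le) (Finset.mem_univ i)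

theorem mu_pos (h : LocalSetting P zs lh C gam l z lam s) (i : Fin m) :
    ∀ᶠ k in l, 0 < dmu (lam k) (s k) := by
  filter_upwards [h.central, h.mul_le i] with k hk hi
  have hm : (0 : ℝ) < m := by exact_mod_cast i.pos
  have := mul_pos (hk.2.2.1 i) (hk.2.2.2.1 i)
  exact pos_of_mul_pos_right (this.trans_le hi) hm.le

theorem slack_isBigO (h : LocalSetting P zs lh C gam l z lam s) (i : Fin m) :
    (fun k => P.g i (z k) + s k i) =O[l] fun k => dmu (lam k) (s k) := by
  refine IsBigO.of_bound C ?_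
  filter_upwards [h.central, h.mu_nonneg] with k hk hmu
  rw [Real.norm_of_nonneg hmu]
  exact (abs_le_evnorm (fun i => P.g i (z k) + s k i) i).trans hk.2.1

theorem Lz_isBigO (h : LocalSetting P zs lh C gam l z lam s) :
    (fun k => P.Lz (z k) (lam k)) =O[l] fun k => dmu (lam k) (s k) := by
  refine IsBigO.of_bound C ?_
  filter_upwards [h.central, h.mu_nonneg] with k hk hmu
  rw [Real.norm_of_nonneg hmu]
  exact (norm_le_evnorm _).trans hk.1

theorem tendsto_slack (h : LocalSetting P zs lh C gam l z lam s) (i : Fin m) :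
    Tendsto (fun k => s k i) l (𝓝 (-P.g i zs)) := by
  have h1 := (h.slack_isBigO i).trans_tendsto h.tendsto_mu
  have h2 : Tendsto (fun k => P.g i (z k)) l (𝓝 (P.g i zs)) :=
    (P.grad_g i zs).continuousAt.tendsto.comp h.tendsto_z
  simpa using h1.sub h2

theorem slack_inactive_ge (h : LocalSetting P zs lh C gam l z lam s) {i : Fin m}
    (hi : P.g i zs ≠ 0) : ∃ c : ℝ, 0 < c ∧ ∀ᶠ k in l, c ≤ s k i := by
  have hneg : 0 < -P.g i zs := neg_pos.2 (lt_of_le_of_ne (h.multiplier.2.1 i) hi)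
  refine ⟨-P.g i zs / 2, by positivity, ?_⟩
  exact (h.tendsto_slack i).eventually_const_le (by linarith)

theorem lam_inactive_isBigO (h : LocalSetting P zs lh C gam l z lam s) {i : Fin m}
    (hi : P.g i zs ≠ 0) : (fun k => lam k i) =O[l] fun k => dmu (lam k) (s k) := by
  obtain ⟨c, hc, hs⟩ := h.slack_inactive_ge hi
  refine IsBigO.of_bound (m / c) ?_
  filter_upwards [h.central, h.mu_nonneg, h.mul_le i, hs] with k hk hmu hle hsk
  have hl := hk.2.2.1 i
  rw [Real.norm_of_nonneg hmu, Real.norm_of_nonneg hl.le, div_mul_eq_mul_div, le_div_iff₀ hc]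
  exact (mul_le_mul_of_nonneg_left hsk hl.le).trans hle

theorem tendsto_lam_apply (h : LocalSetting P zs lh C gam l z lam s) (i : Fin m) :
    Tendsto (fun k => lam k i) l (𝓝 (lh i)) :=
  (tendsto_pi_nhds.1 h.tendsto_lam) i

theorem multiplier_inactive (h : LocalSetting P zs lh C gam l z lam s) {i : Fin m}
    (hi : P.g i zs ≠ 0) : lh i = 0 :=
  NLP.KKT.multiplier_eq_zero h.multiplier hi

theorem tendsto_sub (h : LocalSetting P zs lh C gam l z lam s) :
    Tendsto (fun k => z k - zs) l (𝓝 0) := by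
  simpa using h.tendsto_z.sub_const zs

/-- First-order expansion of the gradient of the Lagrangian at the solution. -/
theorem Lz_expansion (h : LocalSetting P zs lh C gam l z lam s) :
    (fun k => P.Lz (z k) (lam k) - P.Lz zs (lam k) - P.Lzz zs lh *ᵥ (z k - zs))
      =o[l] fun k => z k - zs := by
  have e : (fun k => P.Lz (z k) (lam k) - P.Lz zs (lam k) - P.Lzz zs lh *ᵥ (z k - zs))
      = fun k => (P.gradphi (z k) - P.gradphi zs - P.hessphi zs *ᵥ (z k - zs))
        + ∑ i, (lam k i • (P.gradg i (z k) - P.gradg i zs - P.hessg i zs *ᵥ (z k - zs))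
          + (lam k i - lh i) • (P.hessg i zs *ᵥ (z k - zs))) := by
    funext k
    have : ∀ i, lam k i • (P.gradg i (z k) - P.gradg i zs - P.hessg i zs *ᵥ (z k - zs))
          + (lam k i - lh i) • (P.hessg i zs *ᵥ (z k - zs))
        = lam k i • P.gradg i (z k) - lam k i • P.gradg i zs
          - lh i • (P.hessg i zs *ᵥ (z k - zs)) := fun i => by module
    simp only [this, NLP.Lz_eq, NLP.Lzz_mulVec, Finset.sum_sub_distrib]
    module
  rw [e]
  have h0 : (fun k => P.gradphi (z k) - P.gradphi zs - P.hessphi zs *ᵥ (z k - zs))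
      =o[l] fun k => z k - zs := (NLP.gradphi_isLittleO zs).comp_tendsto h.tendsto_z
  refine h0.add (IsLittleO.fun_sum fun i _ => IsLittleO.add ?_ ?_)
  · have h1 := (h.tendsto_lam_apply i).isBigO_one ℝ
    have h2 := h1.smul_isLittleO ((NLP.gradg_isLittleO (P := P) i zs).comp_tendsto h.tendsto_z)
    simpa only [Function.comp_def, one_smul] using h2
  · have h1 : (fun k => lam k i - lh i) =o[l] fun _ => (1 : ℝ) := by
      rw [isLittleO_one_iff]
      simpa using (h.tendsto_lam_apply i).sub_const (lh i)
    have h2 : (fun k => P.hessg i zs *ᵥ (z k - zs)) =O[l] fun k => z k - zs :=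
      IsBigO.of_bound _ (Eventually.of_forall fun k => norm_mulVec_le _ _)
    simpa only [one_smul] using h1.smul_isBigO h2

end LocalSetting

namespace NLP

variable {n m : ℕ} (P : NLP n m)

/-- The transposed gradient matrix of the active constraints at `zs`, with the rows of the
inactive constraints set to zero. -/
def activeJac (zs : Fin n → ℝ) : Matrix (Fin m) (Fin n) ℝ :=
  Matrix.of fun i j => if P.g i zs = 0 then P.gradg i zs j else 0

variable {P}

theorem activeJac_mulVec (zs w : Fin n → ℝ) (i : Fin m) :
    (P.activeJac zs *ᵥ w) i = if P.g i zs = 0 then P.gradg i zs ⬝ᵥ w else 0 := by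
  by_cases hi : P.g i zs = 0 <;> simp [activeJac, Matrix.mulVec, dotProduct, hi]

theorem activeJac_transpose_mulVec (zs : Fin n → ℝ) (p : Fin m → ℝ) :
    (P.activeJac zs)ᵀ *ᵥ p = ∑ i, (if P.g i zs = 0 then p i else 0) • P.gradg i zs := by
  ext j
  simp only [activeJac, Matrix.mulVec, dotProduct, Matrix.transpose_apply, Matrix.of_apply,
    Finset.sum_apply, Pi.smul_apply, smul_eq_mul]
  refine Finset.sum_congr rfl fun i _ => ?_
  by_cases hi : P.g i zs = 0 <;> simp [hi, mul_comm]

theorem Slam_convex (zs : Fin n → ℝ) : Convex ℝ (P.Slam zs) := by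
  rintro x ⟨hx1, hx2, hx3, hx4⟩ y ⟨hy1, -, hy3, hy4⟩ a b ha hb hab
  refine ⟨?_, hx2, fun i => ?_, ?_⟩
  · have : P.Lz zs (a • x + b • y) = a • P.Lz zs x + b • P.Lz zs y := by
      have e : ∀ i, (a • x + b • y) i • P.gradg i zs
          = a • (x i • P.gradg i zs) + b • (y i • P.gradg i zs) := fun i => by
        simp only [Pi.add_apply, Pi.smul_apply, smul_eq_mul]
        module
      simp only [Lz_eq, e, Finset.sum_add_distrib, ← Finset.smul_sum]
      obtain rfl : b = 1 - a := by linarith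
      module
    rw [this, hx1, hy1, smul_zero, smul_zero, add_zero]
  · exact add_nonneg (mul_nonneg ha (hx3 i)) (mul_nonneg hb (hy3 i))
  · have e : ∀ i, (a • x + b • y) i * P.g i zs = a * (x i * P.g i zs) + b * (y i * P.g i zs) :=
      fun i => by
        simp only [Pi.add_apply, Pi.smul_apply, smul_eq_mul]
        ring
    simp only [e, Finset.sum_add_distrib, ← Finset.mul_sum, hx4, hy4, mul_zero, add_zero]

theorem exists_strict_multiplier {zs : Fin n → ℝ} (hsc : P.StrictComp zs)
    (hne : (P.Slam zs).Nonempty) : ∃ ls ∈ P.Slam zs, ∀ i, P.g i zs = 0 → 0 < ls i := by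
  rcases isEmpty_or_nonempty (Fin m) with hm | hm
  · obtain ⟨ls, hls⟩ := hne
    exact ⟨ls, hls, fun i => isEmptyElim i⟩
  have hex : ∀ i, ∃ ls ∈ P.Slam zs, P.g i zs = 0 → 0 < ls i := by
    intro i
    by_cases hi : P.g i zs = 0
    · obtain ⟨-, ls, hls, hpos⟩ := hsc i hi
      exact ⟨ls, hls, fun _ => hpos⟩
    · obtain ⟨ls, hls⟩ := hne
      exact ⟨ls, hls, fun h => absurd h hi⟩
  choose f hf hpos using hex
  have hc : (0 : ℝ) < (Fintype.card (Fin m) : ℝ)⁻¹ := by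
    have := Fintype.card_pos (α := Fin m)
    positivity
  refine ⟨∑ j, (Fintype.card (Fin m) : ℝ)⁻¹ • f j,
    (Slam_convex zs).sum_mem (fun _ _ => hc.le) ?_ (fun j _ => hf j), fun i hi => ?_⟩
  · rw [Finset.sum_const, nsmul_eq_mul, Finset.card_univ]
    exact mul_inv_cancel₀ (inv_pos.1 hc).ne'
  · rw [Finset.sum_apply]
    refine Finset.sum_pos' (fun j _ => ?_) ⟨i, Finset.mem_univ i, ?_⟩
    · exact mul_nonneg hc.le ((hf j).2.2.1 i)
    · exact mul_pos hc (hpos i hi)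

theorem SOC.quadForm_ge {zs : Fin n → ℝ} (hsoc : P.SOC zs) (hsc : P.StrictComp zs) :
    ∃ ξ : ℝ, 0 < ξ ∧ ∀ ls ∈ P.Slam zs, ∀ w : Fin n → ℝ, P.activeJac zs *ᵥ w = 0 →
      ξ * evnorm w ^ 2 ≤ w ⬝ᵥ P.Lzz zs ls *ᵥ w := by
  obtain ⟨ξ, hξ, h⟩ := hsoc
  refine ⟨ξ, hξ, fun ls hls w hw => h ls hls w (fun i hi => ?_) fun i hi hn => absurd (hsc i hi) hn⟩
  have := congrFun hw i
  rwa [activeJac_mulVec, if_pos hi.1] at this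

end NLP

namespace LocalSetting

variable {n m : ℕ} {P : NLP n m} {zs : Fin n → ℝ} {lh : Fin m → ℝ} {C gam : ℝ}
  {ι : Type*} {l : Filter ι} {z : ι → Fin n → ℝ} {lam s : ι → Fin m → ℝ}

theorem quadForm_isBigO (H : Matrix (Fin n) (Fin n) ℝ) (d : ι → Fin n → ℝ) :
    (fun k => d k ⬝ᵥ H *ᵥ d k) =O[l] fun k => ‖d k‖ ^ 2 := by
  refine IsBigO.of_bound (Fintype.card (Fin n) * entrySum H) (Eventually.of_forall fun k => ?_)
  rw [Real.norm_of_nonneg (by positivity : 0 ≤ ‖d k‖ ^ 2), pow_two]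
  exact abs_quadForm_le H (d k) (d k)

theorem constraint_taylor (h : LocalSetting P zs lh C gam l z lam s) (i : Fin m) :
    (fun k => P.g i (z k) - P.g i zs - P.gradg i zs ⬝ᵥ (z k - zs)
      - 1 / 2 * ((z k - zs) ⬝ᵥ P.hessg i zs *ᵥ (z k - zs))) =o[l] fun k => ‖z k - zs‖ ^ 2 :=
  (taylor_two_isLittleO (P.hessg_symm i zs) (P.grad_g i) (P.hess_g i zs)).comp_tendsto h.tendsto_z

theorem constraint_linearization (h : LocalSetting P zs lh C gam l z lam s) (i : Fin m) :
    (fun k => P.g i (z k) - P.g i zs - P.gradg i zs ⬝ᵥ (z k - zs))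
      =O[l] fun k => ‖z k - zs‖ ^ 2 := by
  have h1 := (h.constraint_taylor i).isBigO.add
    ((quadForm_isBigO (l := l) (P.hessg i zs) fun k => z k - zs).const_mul_left (1 / 2))
  simpa using h1

theorem activeJac_add_slack (h : LocalSetting P zs lh C gam l z lam s) {i : Fin m}
    (hi : P.g i zs = 0) :
    (fun k => P.gradg i zs ⬝ᵥ (z k - zs) + s k i)
      =O[l] fun k => dmu (lam k) (s k) + ‖z k - zs‖ ^ 2 := by
  have e1 : (fun k => dmu (lam k) (s k)) =O[l] fun k => dmu (lam k) (s k) + ‖z k - zs‖ ^ 2 := by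
    refine IsBigO.of_bound 1 ?_
    filter_upwards [h.mu_nonneg] with k hk
    rw [Real.norm_of_nonneg hk, Real.norm_of_nonneg (by positivity), one_mul]
    nlinarith [norm_nonneg (z k - zs)]
  have e2 : (fun k => ‖z k - zs‖ ^ 2) =O[l] fun k => dmu (lam k) (s k) + ‖z k - zs‖ ^ 2 := by
    refine IsBigO.of_bound 1 ?_
    filter_upwards [h.mu_nonneg] with k hk
    rw [Real.norm_of_nonneg (by positivity), Real.norm_of_nonneg (by positivity), one_mul]
    linarith
  have h1 := ((h.slack_isBigO i).trans e1).sub ((h.constraint_linearization i).trans e2)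
  refine h1.congr_left fun k => ?_
  rw [hi]
  ring

/-- Taylor expansion of the constraints weighted by a difference of multipliers. -/
theorem weighted_constraint_expansion (h : LocalSetting P zs lh C gam l z lam s)
    {ls : Fin m → ℝ} (hls : ls ∈ P.Slam zs) :
    (fun k => ∑ i, (lam k i - ls i) * (P.g i (z k) - P.g i zs)
      - P.Lz zs (lam k) ⬝ᵥ (z k - zs)
      - 1 / 2 * ((z k - zs) ⬝ᵥ P.Lzz zs lh *ᵥ (z k - zs)
        - (z k - zs) ⬝ᵥ P.Lzz zs ls *ᵥ (z k - zs))) =o[l] fun k => ‖z k - zs‖ ^ 2 := by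
  have key : (fun k => ∑ i, ((lam k i - ls i) * (P.g i (z k) - P.g i zs
        - P.gradg i zs ⬝ᵥ (z k - zs) - 1 / 2 * ((z k - zs) ⬝ᵥ P.hessg i zs *ᵥ (z k - zs)))
      + (lam k i - lh i) * (1 / 2 * ((z k - zs) ⬝ᵥ P.hessg i zs *ᵥ (z k - zs)))))
      =o[l] fun k => ‖z k - zs‖ ^ 2 := by
    refine IsLittleO.fun_sum fun i _ => IsLittleO.add ?_ ?_
    · have h1 := ((h.tendsto_lam_apply i).sub_const (ls i)).isBigO_one ℝ
      simpa only [one_mul] using h1.mul_isLittleO (h.constraint_taylor i)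
    · have h1 : (fun k => lam k i - lh i) =o[l] fun _ => (1 : ℝ) := by
        rw [isLittleO_one_iff]
        simpa using (h.tendsto_lam_apply i).sub_const (lh i)
      have h2 := (quadForm_isBigO (l := l) (P.hessg i zs) fun k => z k - zs).const_mul_left (1 / 2)
      simpa only [one_mul] using h1.mul_isBigO h2
  refine key.congr_left fun k => ?_
  set d := z k - zs
  have e1 : P.Lz zs (lam k) ⬝ᵥ d = ∑ i, (lam k i - ls i) * (P.gradg i zs ⬝ᵥ d) := by
    have e : P.Lz zs (lam k) = ∑ i, (lam k i - ls i) • P.gradg i zs := by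
      have h0 : P.Lz zs (lam k) = P.Lz zs (lam k) - P.Lz zs ls := by rw [hls.1, sub_zero]
      rw [h0]
      simp only [NLP.Lz_eq, sub_smul, Finset.sum_sub_distrib]
      module
    rw [e, sum_dotProduct]
    simp
  have e2 : d ⬝ᵥ P.Lzz zs lh *ᵥ d - d ⬝ᵥ P.Lzz zs ls *ᵥ d
      = ∑ i, (lh i - ls i) * (d ⬝ᵥ P.hessg i zs *ᵥ d) := by
    simp only [NLP.Lzz_mulVec, dotProduct_add, dotProduct_sum, dotProduct_smul, smul_eq_mul,
      sub_mul, Finset.sum_sub_distrib]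
    ring
  rw [e1, e2, Finset.mul_sum, ← Finset.sum_sub_distrib, ← Finset.sum_sub_distrib]
  refine Finset.sum_congr rfl fun i _ => ?_
  ring

/-- Energy inequality obtained by pairing the complementarity products of the iterate with those
of a fixed solution. -/
theorem energy_le (h : LocalSetting P zs lh C gam l z lam s) {ls : Fin m → ℝ}
    (hls : ls ∈ P.Slam zs) :
    ∃ K : ℝ, 0 < K ∧ ∀ ε > 0, ∀ᶠ k in l,
      ∑ i, ls i * s k i + 1 / 2 * ((z k - zs) ⬝ᵥ P.Lzz zs lh *ᵥ (z k - zs)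
        + (z k - zs) ⬝ᵥ P.Lzz zs ls *ᵥ (z k - zs))
      ≤ K * dmu (lam k) (s k) + ε * ‖z k - zs‖ ^ 2 := by
  have hQ : (fun k => ∑ i, (lam k i - ls i) * (P.g i (z k) + s k i)
      - P.Lz (z k) (lam k) ⬝ᵥ (z k - zs)) =O[l] fun k => dmu (lam k) (s k) := by
    refine IsBigO.sub (IsBigO.fun_sum fun i _ => ?_) ?_
    · have h1 := ((h.tendsto_lam_apply i).sub_const (ls i)).isBigO_one ℝ
      simpa only [one_mul] using h1.mul (h.slack_isBigO i)
    · have h1 : (fun k => P.Lz (z k) (lam k) ⬝ᵥ (z k - zs))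
          =O[l] fun k => ‖P.Lz (z k) (lam k)‖ * ‖z k - zs‖ := by
        refine IsBigO.of_bound (Fintype.card (Fin n)) (Eventually.of_forall fun k => ?_)
        rw [Real.norm_of_nonneg (by positivity : 0 ≤ ‖P.Lz (z k) (lam k)‖ * ‖z k - zs‖)]
        exact abs_dotProduct_le _ _
      have h2 := h.Lz_isBigO.norm_left.mul (h.tendsto_sub.isBigO_one ℝ).norm_left
      simpa only [mul_one] using h1.trans h2
  have hT : (fun k => (P.Lz (z k) (lam k) - P.Lz zs (lam k) - P.Lzz zs lh *ᵥ (z k - zs))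
      ⬝ᵥ (z k - zs)) =o[l] fun k => ‖z k - zs‖ ^ 2 := by
    have h1 : (fun k => (P.Lz (z k) (lam k) - P.Lz zs (lam k) - P.Lzz zs lh *ᵥ (z k - zs))
        ⬝ᵥ (z k - zs)) =O[l] fun k =>
        ‖P.Lz (z k) (lam k) - P.Lz zs (lam k) - P.Lzz zs lh *ᵥ (z k - zs)‖ * ‖z k - zs‖ := by
      refine IsBigO.of_bound (Fintype.card (Fin n)) (Eventually.of_forall fun k => ?_)
      rw [norm_mul, norm_norm, norm_norm]
      exact abs_dotProduct_le _ _
    have h2 := h.Lz_expansion.norm_norm.mul_isBigO (isBigO_refl (fun k => ‖z k - zs‖) l)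
    simpa only [pow_two] using h1.trans_isLittleO h2
  obtain ⟨c, hc, hQc⟩ := hQ.exists_pos
  refine ⟨c + m + 1, by positivity, fun ε hε => ?_⟩
  have hT' := isLittleO_iff.1 hT (half_pos hε)
  have hW' := isLittleO_iff.1 (h.weighted_constraint_expansion hls) (half_pos hε)
  filter_upwards [hQc.bound, hT', hW', h.mu_nonneg, h.central] with k hQ hT hW hmu hcent
  rw [Real.norm_of_nonneg (by positivity : (0 : ℝ) ≤ ‖z k - zs‖ ^ 2)] at hT hW
  rw [Real.norm_of_nonneg hmu] at hQ
  have hmm : ∑ i, lam k i * s k i = m * dmu (lam k) (s k) := by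
    rcases Nat.eq_zero_or_pos m with rfl | hm
    · simp
    · rw [dmu, mul_div_cancel₀]
      positivity
  have hg : ∑ i, lam k i * P.g i zs ≤ 0 :=
    Finset.sum_nonpos fun i _ => mul_nonpos_of_nonneg_of_nonpos (hcent.2.2.1 i).le (hls.2.1 i)
  have e1 : ∑ i, (lam k i - ls i) * (P.g i (z k) + s k i)
      - ∑ i, (lam k i - ls i) * (P.g i (z k) - P.g i zs)
      = ∑ i, lam k i * s k i - ∑ i, ls i * s k i + ∑ i, lam k i * P.g i zs := by
    have h0 : ∑ i, ls i * P.g i zs = 0 := hls.2.2.2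
    rw [← add_zero (_ + ∑ i, lam k i * P.g i zs), ← neg_zero, ← h0, ← Finset.sum_sub_distrib,
      ← Finset.sum_sub_distrib, ← Finset.sum_add_distrib, ← Finset.sum_neg_distrib,
      ← Finset.sum_add_distrib]
    refine Finset.sum_congr rfl fun i _ => ?_
    ring
  have e2 : (P.Lz (z k) (lam k) - P.Lz zs (lam k) - P.Lzz zs lh *ᵥ (z k - zs)) ⬝ᵥ (z k - zs)
      = P.Lz (z k) (lam k) ⬝ᵥ (z k - zs) - P.Lz zs (lam k) ⬝ᵥ (z k - zs)
        - (z k - zs) ⬝ᵥ P.Lzz zs lh *ᵥ (z k - zs) := by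
    rw [sub_dotProduct, sub_dotProduct, dotProduct_comm (P.Lzz zs lh *ᵥ (z k - zs))]
  rw [e2] at hT
  have hQ1 := (abs_le.1 hQ).1
  have hT1 := (abs_le.1 hT)
  have hW1 := (abs_le.1 hW)
  have hexp : (c + m + 1) * dmu (lam k) (s k)
      = c * dmu (lam k) (s k) + m * dmu (lam k) (s k) + dmu (lam k) (s k) := by ring
  rw [hexp]
  linarith [hT1.1, hT1.2, hW1.1, hW1.2]

end LocalSetting

theorem le_mul_of_sq_le {a b x y : ℝ} (ha : 0 < a) (hb : 0 < b) (hy : 0 ≤ y)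
    (h : a * x ^ 2 ≤ b * (y ^ 2 + y * x)) : x ≤ (2 * b / a + 1) * y := by
  by_contra! hlt
  have h0 : 0 ≤ 2 * b / a * y := by positivity
  have h1 : y < x := by nlinarith
  have hxp : 0 < x := hy.trans_lt h1
  have h2 : a * x ^ 2 ≤ 2 * b * y * x := by
    nlinarith [mul_nonneg hb.le (mul_nonneg hy (sub_pos.2 h1).le)]
  have h3 : a * x ≤ 2 * b * y := by
    refine le_of_mul_le_mul_right ?_ hxp
    nlinarith
  have h4 : x ≤ 2 * b / a * y := by
    rw [div_mul_eq_mul_div, le_div_iff₀ ha]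
    linarith
  linarith

namespace LocalSetting

variable {n m : ℕ} {P : NLP n m} {zs : Fin n → ℝ} {lh : Fin m → ℝ} {C gam : ℝ}
  {ι : Type*} {l : Filter ι} {z : ι → Fin n → ℝ} {lam s : ι → Fin m → ℝ}

theorem norm_sq_isBigO_and_slack_isBigO (h : LocalSetting P zs lh C gam l z lam s)
    (hsoc : P.SOC zs) (hsc : P.StrictComp zs) :
    (fun k => ‖z k - zs‖ ^ 2) =O[l] (fun k => dmu (lam k) (s k)) ∧
      ∀ i, P.g i zs = 0 → (fun k => s k i) =O[l] fun k => dmu (lam k) (s k) := by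
  obtain ⟨ls, hls, hpos⟩ := NLP.exists_strict_multiplier hsc ⟨lh, h.multiplier⟩
  obtain ⟨ξ₀, hξ₀, hH⟩ := hsoc.quadForm_ge hsc
  obtain ⟨ξ, κ, hξ, hκ, hq⟩ := exists_quadForm_lower_bound
    ((1 / 2 : ℝ) • (P.Lzz zs lh + P.Lzz zs ls)) (P.activeJac zs) hξ₀ fun w hw => by
      have h1 := hH lh h.multiplier w hw
      have h2 := hH ls hls w hw
      rw [Matrix.smul_mulVec, Matrix.add_mulVec, dotProduct_smul, dotProduct_add, smul_eq_mul]
      linarith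
  obtain ⟨K, hK, hE⟩ := h.energy_le hls
  have hSnn : ∀ᶠ k in l, 0 ≤ ∑ i, ls i * s k i := by
    filter_upwards [h.central] with k hk
    exact Finset.sum_nonneg fun i _ => mul_nonneg (hls.2.2.1 i) (hk.2.2.2.1 i).le
  have hsS : ∀ i, P.g i zs = 0 → ∀ᶠ k in l, s k i ≤ (ls i)⁻¹ * ∑ i, ls i * s k i := by
    intro i hi
    filter_upwards [h.central] with k hk
    rw [inv_mul_eq_div, le_div_iff₀ (hpos i hi), mul_comm]
    exact Finset.single_le_sum (f := fun i => ls i * s k i)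
      (fun i _ => mul_nonneg (hls.2.2.1 i) (hk.2.2.2.1 i).le) (Finset.mem_univ i)
  have hA : (fun k => P.activeJac zs *ᵥ (z k - zs)) =O[l]
      fun k => ∑ i, ls i * s k i + (dmu (lam k) (s k) + ‖z k - zs‖ ^ 2) := by
    refine isBigO_pi.2 fun i => ?_
    by_cases hi : P.g i zs = 0
    · obtain ⟨c, hc, hb⟩ := (h.activeJac_add_slack hi).exists_pos
      refine IsBigO.of_bound ((ls i)⁻¹ + c) ?_
      filter_upwards [hb.bound, hsS i hi, hSnn, h.mu_nonneg, h.central] with k h1 h2 h3 h4 h5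
      have hs0 := h5.2.2.2.1 i
      rw [NLP.activeJac_mulVec, if_pos hi]
      have hB1 : 0 ≤ dmu (lam k) (s k) + ‖z k - zs‖ ^ 2 := by positivity
      rw [Real.norm_eq_abs, Real.norm_of_nonneg hB1] at h1
      rw [Real.norm_eq_abs, Real.norm_of_nonneg (add_nonneg h3 hB1)]
      have hc1 : 0 ≤ c * ∑ i, ls i * s k i := by positivity
      have hc2 : 0 ≤ (ls i)⁻¹ * (dmu (lam k) (s k) + ‖z k - zs‖ ^ 2) :=
        mul_nonneg (inv_nonneg.2 (hpos i hi).le) (by positivity)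
      have h6 := abs_le.1 h1
      refine abs_le.2 ⟨?_, ?_⟩ <;> linarith [h6.1, h6.2]
    · simp only [NLP.activeJac_mulVec, if_neg hi]
      exact isBigO_zero _ _
  obtain ⟨c, hc, hAc⟩ := hA.exists_pos
  have hA0 : Tendsto (fun k => ‖P.activeJac zs *ᵥ (z k - zs)‖) l (𝓝 0) := by
    have h1 : (fun k => P.activeJac zs *ᵥ (z k - zs)) =O[l] fun k => z k - zs :=
      IsBigO.of_bound _ (Eventually.of_forall fun k => norm_mulVec_le _ _)
    simpa using (h1.trans_tendsto h.tendsto_sub).norm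
  have hη : 0 < min (1 / 2) (ξ / 4) / (κ * c) := by positivity
  have main : ∀ᶠ k in l, 1 / 2 * ∑ i, ls i * s k i + ξ / 2 * ‖z k - zs‖ ^ 2
      ≤ (K + 1 / 2) * dmu (lam k) (s k) := by
    filter_upwards [hE (ξ / 4) (by positivity), hAc.bound, hA0.eventually_le_const hη, hSnn,
      h.mu_nonneg] with k h1 h2 h3 h4 h5
    set S := ∑ i, ls i * s k i
    set a := ‖P.activeJac zs *ᵥ (z k - zs)‖
    have hq' := hq (z k - zs)
    rw [Matrix.smul_mulVec, Matrix.add_mulVec, dotProduct_smul, dotProduct_add,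
      smul_eq_mul] at hq'
    rw [Real.norm_of_nonneg (by positivity)] at h2
    have ha : 0 ≤ a := norm_nonneg _
    have h6 : κ * a ^ 2 ≤ min (1 / 2) (ξ / 4) * (S + (dmu (lam k) (s k) + ‖z k - zs‖ ^ 2)) := by
      calc κ * a ^ 2 = κ * (a * a) := by ring
        _ ≤ κ * (min (1 / 2) (ξ / 4) / (κ * c)
            * (c * (S + (dmu (lam k) (s k) + ‖z k - zs‖ ^ 2)))) := by gcongr
        _ = _ := by field_simp
    have h7 : min (1 / 2) (ξ / 4) * (S + (dmu (lam k) (s k) + ‖z k - zs‖ ^ 2))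
        ≤ 1 / 2 * (S + dmu (lam k) (s k)) + ξ / 4 * ‖z k - zs‖ ^ 2 := by
      have m1 := mul_le_mul_of_nonneg_right (min_le_left (1 / 2) (ξ / 4)) (add_nonneg h4 h5)
      have m2 := mul_le_mul_of_nonneg_right (min_le_right (1 / 2) (ξ / 4))
        (sq_nonneg ‖z k - zs‖)
      linarith
    linarith
  constructor
  · refine IsBigO.of_bound ((K + 1 / 2) / (ξ / 2)) ?_
    filter_upwards [main, hSnn, h.mu_nonneg] with k h1 h2 h3
    rw [Real.norm_of_nonneg (by positivity), Real.norm_of_nonneg h3, div_mul_eq_mul_div,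
      le_div_iff₀ (by positivity)]
    linarith
  · intro i hi
    refine IsBigO.of_bound ((ls i)⁻¹ * (2 * (K + 1 / 2))) ?_
    filter_upwards [main, hsS i hi, h.mu_nonneg, h.central] with k h1 h2 h3 h4
    rw [Real.norm_of_nonneg (h4.2.2.2.1 i).le, Real.norm_of_nonneg h3, mul_assoc]
    refine h2.trans (mul_le_mul_of_nonneg_left ?_ (inv_nonneg.2 (hpos i hi).le))
    have : 0 ≤ ξ / 2 * ‖z k - zs‖ ^ 2 := by positivity
    linarith

theorem lam_active_ge (h : LocalSetting P zs lh C gam l z lam s) (hsoc : P.SOC zs)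
    (hsc : P.StrictComp zs) {i : Fin m} (hi : P.g i zs = 0) :
    ∃ c : ℝ, 0 < c ∧ ∀ᶠ k in l, c ≤ lam k i := by
  obtain ⟨b, hb, hs⟩ := ((h.norm_sq_isBigO_and_slack_isBigO hsoc hsc).2 i hi).exists_pos
  refine ⟨gam / b, div_pos h.gam_pos hb, ?_⟩
  filter_upwards [hs.bound, h.central, h.mu_pos i] with k h1 h2 h3
  rw [Real.norm_of_nonneg h3.le] at h1
  have hs1 := (le_abs_self _).trans h1
  rw [div_le_iff₀ hb]
  refine le_of_mul_le_mul_right ?_ h3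
  calc gam * dmu (lam k) (s k) ≤ lam k i * s k i := h2.2.2.2.2 i
    _ ≤ lam k i * (b * dmu (lam k) (s k)) := mul_le_mul_of_nonneg_left hs1 (h2.2.2.1 i).le
    _ = lam k i * b * dmu (lam k) (s k) := by ring

theorem activeJac_isBigO (h : LocalSetting P zs lh C gam l z lam s) (hsoc : P.SOC zs)
    (hsc : P.StrictComp zs) :
    (fun k => P.activeJac zs *ᵥ (z k - zs)) =O[l] fun k => dmu (lam k) (s k) := by
  obtain ⟨h1, h2⟩ := h.norm_sq_isBigO_and_slack_isBigO hsoc hsc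
  refine isBigO_pi.2 fun i => ?_
  by_cases hi : P.g i zs = 0
  · have h3 := ((h.activeJac_add_slack hi).trans ((isBigO_refl _ l).add h1)).sub (h2 i hi)
    refine h3.congr_left fun k => ?_
    rw [NLP.activeJac_mulVec, if_pos hi]
    ring
  · simp only [NLP.activeJac_mulVec, if_neg hi]
    exact isBigO_zero _ _

theorem Lz_solution_eq (h : LocalSetting P zs lh C gam l z lam s) (k : ι) :
    P.Lz zs (lam k) = (P.activeJac zs)ᵀ *ᵥ (lam k - lh)
      + ∑ i, (if P.g i zs = 0 then 0 else lam k i) • P.gradg i zs := by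
  have h0 : P.Lz zs (lam k) = P.Lz zs (lam k) - P.Lz zs lh := by rw [h.multiplier.1, sub_zero]
  rw [h0, NLP.Lz_eq, NLP.Lz_eq, add_sub_add_left_eq_sub, NLP.activeJac_transpose_mulVec,
    ← Finset.sum_sub_distrib, ← Finset.sum_add_distrib]
  refine Finset.sum_congr rfl fun i _ => ?_
  by_cases hi : P.g i zs = 0
  · simp only [if_pos hi, Pi.sub_apply]
    module
  · simp [if_neg hi, h.multiplier_inactive hi]

/-- Local error bound for the primal variables. -/
theorem sub_isBigO (h : LocalSetting P zs lh C gam l z lam s) (hsoc : P.SOC zs)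
    (hsc : P.StrictComp zs) :
    (fun k => z k - zs) =O[l] fun k => dmu (lam k) (s k) := by
  obtain ⟨ξ₀, hξ₀, hH⟩ := hsoc.quadForm_ge hsc
  obtain ⟨ξ, κ, hξ, hκ, hq⟩ := exists_quadForm_lower_bound (P.Lzz zs lh) (P.activeJac zs) hξ₀
    (hH lh h.multiplier)
  obtain ⟨b, hb, hpre⟩ := exists_mulVec_eq_norm_le (P.activeJac zs)ᵀ
  obtain ⟨cA, hcA, hA⟩ := (h.activeJac_isBigO hsoc hsc).exists_pos
  have hN : (fun k => ∑ i, (if P.g i zs = 0 then 0 else lam k i) • P.gradg i zs)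
      =O[l] fun k => dmu (lam k) (s k) := by
    refine IsBigO.fun_sum fun i _ => ?_
    by_cases hi : P.g i zs = 0
    · simp only [if_pos hi, zero_smul]
      exact isBigO_zero _ _
    · simp only [if_neg hi]
      refine isBigO_pi.2 fun j => ?_
      simpa [mul_comm] using (h.lam_inactive_isBigO hi).const_mul_left (P.gradg i zs j)
  obtain ⟨cR, hcR, hR⟩ := (h.Lz_isBigO.sub hN).exists_pos
  set N : ℝ := entrySum (P.Lzz zs lh)
  have hN0 : 0 ≤ N := entrySum_nonneg _
  set ε : ℝ := min 1 (ξ / (2 * (n + 1))) with hε_def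
  have hε : 0 < ε := by positivity
  have hε1 : ε ≤ 1 := min_le_left _ _
  have hε2 : n * ε ≤ ξ / 2 := by
    have h1 : ε ≤ ξ / (2 * (n + 1)) := min_le_right _ _
    calc n * ε ≤ (n + 1) * (ξ / (2 * (n + 1))) := by gcongr; linarith
      _ = ξ / 2 := by field_simp
  have hT := isLittleO_iff.1 h.Lz_expansion hε
  set B : ℝ := m * cA * b * (cR + N + 1) + n * cR + κ * cA ^ 2
  refine IsBigO.of_bound (2 * B / (ξ / 2) + 1) ?_
  filter_upwards [hA.bound, hR.bound, hT, h.mu_nonneg] with k hA hR hT hmu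
  have hLz := h.Lz_solution_eq k
  rw [Real.norm_of_nonneg hmu] at hA hR ⊢
  set d := z k - zs
  set μ := dmu (lam k) (s k)
  set v := (P.activeJac zs)ᵀ *ᵥ (lam k - lh) with hv
  set r := P.Lz (z k) (lam k) - ∑ i, (if P.g i zs = 0 then 0 else lam k i) • P.gradg i zs
  set T := P.Lz (z k) (lam k) - P.Lz zs (lam k) - P.Lzz zs lh *ᵥ d with hTdef
  have hD : 0 ≤ ‖d‖ := norm_nonneg d
  have hveq : v = r - P.Lzz zs lh *ᵥ d - T := by
    rw [hTdef, hLz]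
    simp only [r]
    module
  obtain ⟨y, hy, hyn⟩ := hpre (lam k - lh)
  have hvn : ‖v‖ ≤ cR * μ + N * ‖d‖ + ‖d‖ := by
    have h1 : ‖v‖ ≤ ‖r‖ + ‖P.Lzz zs lh *ᵥ d‖ + ‖T‖ := by
      rw [hveq]
      exact (norm_sub_le _ _).trans (add_le_add_left (norm_sub_le _ _) _)
    have h2 := norm_mulVec_le (P.Lzz zs lh) d
    have h3 : ε * ‖d‖ ≤ ‖d‖ := mul_le_of_le_one_left hD hε1
    linarith
  have hdv : |d ⬝ᵥ v| ≤ m * cA * b * (cR + N + 1) * (μ ^ 2 + μ * ‖d‖) := by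
    have e : d ⬝ᵥ v = (P.activeJac zs *ᵥ d) ⬝ᵥ y := by
      rw [hv, ← hy, Matrix.dotProduct_mulVec, Matrix.vecMul_transpose]
    rw [e]
    calc |(P.activeJac zs *ᵥ d) ⬝ᵥ y| ≤ m * (‖P.activeJac zs *ᵥ d‖ * ‖y‖) := by
          simpa using abs_dotProduct_le (P.activeJac zs *ᵥ d) y
      _ ≤ m * ((cA * μ) * (b * (cR * μ + N * ‖d‖ + ‖d‖))) := by
          gcongr
          exact hyn.trans (mul_le_mul_of_nonneg_left hvn hb.le)
      _ ≤ m * ((cA * μ) * (b * ((cR + N + 1) * (μ + ‖d‖)))) := by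
          gcongr
          nlinarith [mul_nonneg hN0 hmu, mul_nonneg hcR.le hD]
      _ = _ := by ring
  have hdr : |d ⬝ᵥ r| ≤ n * (‖d‖ * (cR * μ)) := by
    refine (by simpa using abs_dotProduct_le d r : |d ⬝ᵥ r| ≤ n * (‖d‖ * ‖r‖)).trans ?_
    gcongr
  have hdT : |d ⬝ᵥ T| ≤ ξ / 2 * ‖d‖ ^ 2 := by
    refine (by simpa using abs_dotProduct_le d T : |d ⬝ᵥ T| ≤ n * (‖d‖ * ‖T‖)).trans ?_
    calc n * (‖d‖ * ‖T‖) ≤ n * (‖d‖ * (ε * ‖d‖)) := by gcongr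
      _ = n * ε * ‖d‖ ^ 2 := by ring
      _ ≤ ξ / 2 * ‖d‖ ^ 2 := by gcongr
  have hquad : d ⬝ᵥ P.Lzz zs lh *ᵥ d = d ⬝ᵥ r - d ⬝ᵥ v - d ⬝ᵥ T := by
    rw [hveq]
    simp only [dotProduct_sub]
    ring
  have hA2 : κ * ‖P.activeJac zs *ᵥ d‖ ^ 2 ≤ κ * cA ^ 2 * μ ^ 2 := by
    rw [mul_assoc, ← mul_pow]
    gcongr
  refine le_mul_of_sq_le (by positivity) (by positivity) hmu ?_
  have hqd := hq d
  rw [hquad] at hqd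
  have p1 : 0 ≤ n * cR * μ ^ 2 := by positivity
  have p2 : 0 ≤ κ * cA ^ 2 * (μ * ‖d‖) := by positivity
  have e : B * (μ ^ 2 + μ * ‖d‖) = m * cA * b * (cR + N + 1) * (μ ^ 2 + μ * ‖d‖)
      + n * (‖d‖ * (cR * μ)) + n * cR * μ ^ 2 + κ * cA ^ 2 * μ ^ 2
      + κ * cA ^ 2 * (μ * ‖d‖) := by
    simp only [B]
    ring
  rw [e]
  linarith [(abs_le.1 hdr).2, (abs_le.1 hdv).1, (abs_le.1 hdT).1]

end LocalSetting

theorem exists_absorption {ξ c F : ℝ} (hξ : 0 < ξ) (hc : 0 < c) (hF : 0 < F) :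
    ∃ B δ : ℝ, 0 < B ∧ 0 < δ ∧ δ ≤ 1 ∧ ∀ μ x y : ℝ, 0 ≤ μ → 0 ≤ x → μ ≤ δ →
      ξ * x ^ 2 + c * (μ * y ^ 2) ≤ ξ / 8 * x ^ 2
        + F * (μ * x + μ * x * y + μ ^ 2 * y + μ ^ 2 * (y ^ 2 + μ ^ 2 + x ^ 2)) →
      ξ / 2 * x ^ 2 + c / 2 * (μ * y ^ 2) ≤ B * (μ ^ 2 + μ * x) := by
  refine ⟨2 * F ^ 2 / c + F, min 1 (min (ξ / (8 * F)) (min (c / (8 * F)) (c * ξ / (16 * F ^ 2)))),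
    by positivity, by positivity, min_le_left _ _, fun μ x y hμ hx hδ h => ?_⟩
  simp only [le_min_iff] at hδ
  obtain ⟨h1, h2, h3, h4⟩ := hδ
  rw [le_div_iff₀ (by positivity)] at h2 h3 h4
  have hμ2 : μ ^ 2 ≤ μ := by nlinarith
  have hμ3 : μ ^ 3 ≤ μ ^ 2 := by nlinarith [sq_nonneg μ]
  have hμ4 : μ ^ 4 ≤ μ ^ 2 := by nlinarith [sq_nonneg μ]
  have t1 : F * (μ ^ 2 * x ^ 2) ≤ ξ / 8 * x ^ 2 := by
    have : F * μ ^ 2 ≤ ξ / 8 := by nlinarith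
    nlinarith [sq_nonneg x]
  have t2 : F * (μ ^ 2 * y ^ 2) ≤ c / 8 * (μ * y ^ 2) := by
    have : F * μ ≤ c / 8 := by linarith
    nlinarith [mul_nonneg hμ (sq_nonneg y)]
  have t3 : F * (μ * x * y) ≤ ξ / 8 * x ^ 2 + c / 8 * (μ * y ^ 2) := by
    have e : ξ / 8 * x ^ 2 + 2 * F ^ 2 / ξ * (μ ^ 2 * y ^ 2) - F * (μ * x * y)
        = (ξ * x - 4 * F * (μ * y)) ^ 2 / (8 * ξ) := by
      field_simp
      ring
    have h0 : 0 ≤ (ξ * x - 4 * F * (μ * y)) ^ 2 / (8 * ξ) := by positivity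
    have h5 : 2 * F ^ 2 / ξ * μ ≤ c / 8 := by
      rw [div_mul_eq_mul_div, div_le_iff₀ hξ]
      linarith
    have h6 : 2 * F ^ 2 / ξ * (μ ^ 2 * y ^ 2) ≤ c / 8 * (μ * y ^ 2) := by
      calc 2 * F ^ 2 / ξ * (μ ^ 2 * y ^ 2) = 2 * F ^ 2 / ξ * μ * (μ * y ^ 2) := by ring
        _ ≤ _ := mul_le_mul_of_nonneg_right h5 (by positivity)
    linarith
  have t4 : F * (μ ^ 2 * y) ≤ c / 8 * (μ * y ^ 2) + 2 * F ^ 2 / c * μ ^ 3 := by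
    have e : c / 8 * (μ * y ^ 2) + 2 * F ^ 2 / c * μ ^ 3 - F * (μ ^ 2 * y)
        = μ * (c * y - 4 * F * μ) ^ 2 / (8 * c) := by
      field_simp
      ring
    have h0 : 0 ≤ μ * (c * y - 4 * F * μ) ^ 2 / (8 * c) := by positivity
    linarith
  have t5 : 2 * F ^ 2 / c * μ ^ 3 ≤ 2 * F ^ 2 / c * μ ^ 2 := by gcongr
  have t6 : F * μ ^ 4 ≤ F * μ ^ 2 := by gcongr
  have e : F * (μ * x + μ * x * y + μ ^ 2 * y + μ ^ 2 * (y ^ 2 + μ ^ 2 + x ^ 2))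
      = F * (μ * x) + F * (μ * x * y) + F * (μ ^ 2 * y) + F * (μ ^ 2 * y ^ 2) + F * μ ^ 4
        + F * (μ ^ 2 * x ^ 2) := by ring
  rw [e] at h
  have hx0 : 0 ≤ x ^ 2 := sq_nonneg x
  have hy0 : 0 ≤ c * (μ * y ^ 2) := by positivity
  have h7 : 0 ≤ 2 * F ^ 2 / c * (μ * x) := by positivity
  have h8 : (2 * F ^ 2 / c + F) * (μ ^ 2 + μ * x)
      = 2 * F ^ 2 / c * μ ^ 2 + F * μ ^ 2 + F * (μ * x) + 2 * F ^ 2 / c * (μ * x) := by ring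
  have h9 : 0 ≤ ξ * x ^ 2 := by positivity
  rw [h8]
  linarith

/-- A priori bound for the regularized saddle-point system satisfied by a Newton step. -/
theorem saddle_point_bound {n m : ℕ} {H : Matrix (Fin n) (Fin n) ℝ}
    {A : Matrix (Fin m) (Fin n) ℝ} {ξ κ c C : ℝ} (hξ : 0 < ξ) (hκ : 0 < κ)
    (hq : ∀ w, ξ * ‖w‖ ^ 2 ≤ w ⬝ᵥ H *ᵥ w + κ * ‖A *ᵥ w‖ ^ 2) (hc : 0 < c) (hC : 0 < C) :
    ∃ K δ : ℝ, 0 < K ∧ 0 < δ ∧ ∀ (μ : ℝ) (w : Fin n → ℝ) (p D : Fin m → ℝ), 0 ≤ μ → μ ≤ δ →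
      ‖H *ᵥ w + Aᵀ *ᵥ p‖ ≤ C * μ + δ * ‖w‖ + C * (μ * ‖p‖) →
      (∀ i, |(A *ᵥ w) i - D i * p i| ≤ C * (μ * (μ + ‖w‖))) →
      (∀ i, c * μ ≤ D i) → (∀ i, D i ≤ C * μ) → (μ = 0 → p = 0) →
      ‖w‖ ≤ K * μ ∧ ‖p‖ ≤ K := by
  have hself : ∀ r : ℝ, r ≤ r ^ 2 + 1 := fun r => by nlinarith [sq_nonneg (r - 1 / 2)]
  set F : ℝ := n * C + m * C + 3 * κ * C ^ 2 with hFdef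
  have hF : 0 < F := by positivity
  obtain ⟨B, δ₀, hB, hδ₀, hδ1, habs⟩ := exists_absorption hξ hc hF
  set δ : ℝ := min δ₀ (ξ / (8 * (n + 1))) with hδ_def
  have hδ : 0 < δ := by positivity
  have hnδ : n * δ ≤ ξ / 8 := by
    have h1 : δ ≤ ξ / (8 * (n + 1)) := min_le_right _ _
    calc n * δ ≤ (n + 1) * (ξ / (8 * (n + 1))) := by gcongr; linarith
      _ = ξ / 8 := by field_simp
  set K₁ : ℝ := 2 * B / (ξ / 2) + 1 with hK₁def
  have hK₁ : 0 < K₁ := by positivity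
  set K₂ : ℝ := B * (1 + K₁) / (c / 2) + 1 with hK₂def
  have hK₂ : 0 < K₂ := by positivity
  refine ⟨K₁ + K₂, δ, by positivity, hδ, fun μ w p D hμ hμδ h1 h2 h3 h4 h5 => ?_⟩
  have hμ1 : μ ≤ 1 := (hμδ.trans (min_le_left _ _)).trans hδ1
  set x := ‖w‖ with hx
  set y := ‖p‖ with hy
  have hx0 : 0 ≤ x := norm_nonneg w
  have hy0 : 0 ≤ y := norm_nonneg p
  have hD0 : ∀ i, 0 ≤ D i := fun i => (mul_nonneg hc.le hμ).trans (h3 i)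
  have hwu : |w ⬝ᵥ (H *ᵥ w + Aᵀ *ᵥ p)| ≤ n * (x * (C * μ + δ * x + C * (μ * y))) := by
    refine (by simpa using abs_dotProduct_le w (H *ᵥ w + Aᵀ *ᵥ p) :
      |w ⬝ᵥ (H *ᵥ w + Aᵀ *ᵥ p)| ≤ n * (‖w‖ * ‖H *ᵥ w + Aᵀ *ᵥ p‖)).trans ?_
    gcongr
  have hsplit : w ⬝ᵥ (H *ᵥ w + Aᵀ *ᵥ p) = w ⬝ᵥ H *ᵥ w + ∑ i, (A *ᵥ w) i * p i := by
    rw [dotProduct_add, Matrix.dotProduct_mulVec w Aᵀ, Matrix.vecMul_transpose]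
    rfl
  have hpair : c * (μ * y ^ 2) - m * (C * (μ * (μ + x)) * y) ≤ ∑ i, (A *ᵥ w) i * p i := by
    have e1 : c * (μ * y ^ 2) ≤ ∑ i, D i * p i ^ 2 := by
      calc c * (μ * y ^ 2) = c * μ * y ^ 2 := by ring
        _ ≤ c * μ * ∑ i, p i ^ 2 := by gcongr; exact norm_sq_le_sum_sq p
        _ = ∑ i, c * μ * p i ^ 2 := Finset.mul_sum _ _ _
        _ ≤ ∑ i, D i * p i ^ 2 :=
          Finset.sum_le_sum fun i _ => mul_le_mul_of_nonneg_right (h3 i) (sq_nonneg _)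
    have e2 : ∑ i, (D i * p i ^ 2 - C * (μ * (μ + x)) * y) ≤ ∑ i, (A *ᵥ w) i * p i := by
      refine Finset.sum_le_sum fun i _ => ?_
      have e3 : |((A *ᵥ w) i - D i * p i) * p i| ≤ C * (μ * (μ + x)) * y := by
        rw [abs_mul]
        exact mul_le_mul (h2 i) (abs_apply_le_norm p i) (abs_nonneg _) (by positivity)
      have e4 := (abs_le.1 e3).1
      nlinarith
    rw [Finset.sum_sub_distrib] at e2
    simp only [Finset.sum_const, Finset.card_univ, Fintype.card_fin, nsmul_eq_mul] at e2
    linarith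
  have hAw : ‖A *ᵥ w‖ ≤ C * (μ * (y + μ + x)) := by
    refine (pi_norm_le_iff_of_nonneg (by positivity)).2 fun i => ?_
    have e1 : |D i * p i| ≤ C * μ * y := by
      rw [abs_mul, abs_of_nonneg (hD0 i)]
      exact mul_le_mul (h4 i) (abs_apply_le_norm p i) (abs_nonneg _) (by positivity)
    have e2 := abs_le.1 e1
    have e3 := abs_le.1 (h2 i)
    exact abs_le.2 ⟨by linarith, by linarith⟩
  have hAw2 : κ * ‖A *ᵥ w‖ ^ 2 ≤ 3 * κ * C ^ 2 * (μ ^ 2 * (y ^ 2 + μ ^ 2 + x ^ 2)) := by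
    calc κ * ‖A *ᵥ w‖ ^ 2 ≤ κ * (C * (μ * (y + μ + x))) ^ 2 := by gcongr
      _ = κ * C ^ 2 * μ ^ 2 * (y + μ + x) ^ 2 := by ring
      _ ≤ κ * C ^ 2 * μ ^ 2 * (3 * (y ^ 2 + μ ^ 2 + x ^ 2)) := by
          gcongr
          nlinarith [sq_nonneg (y - μ), sq_nonneg (y - x), sq_nonneg (μ - x)]
      _ = _ := by ring
  have hmain : ξ / 2 * x ^ 2 + c / 2 * (μ * y ^ 2) ≤ B * (μ ^ 2 + μ * x) := by
    refine habs μ x y hμ hx0 (hμδ.trans (min_le_left _ _)) ?_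
    have q := hq w
    rw [← hx] at q
    have d1 : n * (x * (C * μ + δ * x + C * (μ * y)))
        = n * C * (μ * x + μ * x * y) + n * δ * x ^ 2 := by ring
    have d2 : n * δ * x ^ 2 ≤ ξ / 8 * x ^ 2 := by gcongr
    have d3 : m * (C * (μ * (μ + x)) * y) = m * C * (μ ^ 2 * y + μ * x * y) := by ring
    have g1 : 0 ≤ n * C * (μ ^ 2 * y + μ ^ 2 * (y ^ 2 + μ ^ 2 + x ^ 2)) := by positivity
    have g2 : 0 ≤ m * C * (μ * x + μ ^ 2 * (y ^ 2 + μ ^ 2 + x ^ 2)) := by positivity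
    have g3 : 0 ≤ 3 * κ * C ^ 2 * (μ * x + μ * x * y + μ ^ 2 * y) := by positivity
    have e := (abs_le.1 hwu).2
    rw [hsplit, d1] at e
    rw [d3] at hpair
    rw [hFdef]
    linarith
  have hxK : x ≤ K₁ * μ := by
    refine le_mul_of_sq_le (by positivity) hB hμ ?_
    have : 0 ≤ c / 2 * (μ * y ^ 2) := by positivity
    linarith
  refine ⟨hxK.trans (mul_le_mul_of_nonneg_right (by linarith) hμ), ?_⟩
  rcases hμ.eq_or_lt with h0 | hpos
  · rw [hy, h5 h0.symm, norm_zero]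
    positivity
  · have e1 : c / 2 * (μ * y ^ 2) ≤ B * (1 + K₁) * μ * μ := by
      have : 0 ≤ ξ / 2 * x ^ 2 := by positivity
      have : B * (μ * x) ≤ B * (μ * (K₁ * μ)) := by gcongr
      linarith
    have e2 : c / 2 * y ^ 2 ≤ B * (1 + K₁) := by
      have e3 : c / 2 * y ^ 2 ≤ B * (1 + K₁) * μ := by
        refine le_of_mul_le_mul_right ?_ hpos
        linarith
      exact e3.trans (mul_le_of_le_one_right (by positivity) hμ1)
    have e3 : y ^ 2 ≤ B * (1 + K₁) / (c / 2) := by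
      rw [le_div_iff₀ (by positivity)]
      linarith
    exact (hself y).trans (by linarith)

/-- The dual part of the regularized saddle-point system is controlled by the regularization
parameter. -/
theorem saddle_point_dual_bound {n m : ℕ} {H : Matrix (Fin n) (Fin n) ℝ}
    {A : Matrix (Fin m) (Fin n) ℝ} {c C K δ : ℝ} (hc : 0 < c) (hC : 0 < C) (hK : 0 < K)
    (hδ : 0 < δ) :
    ∃ M : ℝ, 0 < M ∧ ∀ (μ : ℝ) (w : Fin n → ℝ) (p D : Fin m → ℝ), 0 ≤ μ →
      ‖H *ᵥ w + Aᵀ *ᵥ p‖ ≤ C * μ + δ * ‖w‖ + C * (μ * ‖p‖) →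
      (∀ i, |(A *ᵥ w) i - D i * p i| ≤ C * (μ * (μ + ‖w‖))) →
      (∀ i, c * μ ≤ D i) → (∀ i, D i ≤ C * μ) → (μ = 0 → p = 0) →
      ‖w‖ ≤ K * μ → ‖p‖ ≤ K → ‖p‖ ≤ M * μ := by
  obtain ⟨b, hb, hpre⟩ := exists_mulVec_eq_norm_le Aᵀ
  set N : ℝ := entrySum H
  have hN : 0 ≤ N := entrySum_nonneg H
  set K₁ : ℝ := C + δ * K + C * K + N * K
  have hK₁ : 0 < K₁ := by positivity
  set K₂ : ℝ := m * C * (b * K₁ + 1 + K) / c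
  have hK₂ : 0 ≤ K₂ := by positivity
  refine ⟨K₂ + b * K₁, by positivity, fun μ w p D hμ h1 h2 h3 h4 h5 hw hp => ?_⟩
  rcases hμ.eq_or_lt with h0 | hpos
  · rw [h5 h0.symm, ← h0]
    simp
  obtain ⟨q, hq, hqn⟩ := hpre p
  have hAp : ‖Aᵀ *ᵥ p‖ ≤ K₁ * μ := by
    have e : Aᵀ *ᵥ p = (H *ᵥ w + Aᵀ *ᵥ p) - H *ᵥ w := by abel
    have e1 : ‖Aᵀ *ᵥ p‖ ≤ ‖H *ᵥ w + Aᵀ *ᵥ p‖ + ‖H *ᵥ w‖ := by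
      rw [e]
      simpa only [← e] using norm_sub_le (H *ᵥ w + Aᵀ *ᵥ p) (H *ᵥ w)
    have e2 : ‖H *ᵥ w‖ ≤ N * (K * μ) := (norm_mulVec_le H w).trans (by gcongr)
    have e3 : δ * ‖w‖ ≤ δ * (K * μ) := by gcongr
    have e4 : C * (μ * ‖p‖) ≤ C * (μ * K) := by gcongr
    have e5 : K₁ * μ = C * μ + δ * (K * μ) + C * (μ * K) + N * (K * μ) := by
      simp only [K₁]
      ring
    linarith
  have hqn' : ‖q‖ ≤ b * (K₁ * μ) := hqn.trans (by gcongr)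
  set v := p - q with hv
  have hAv : Aᵀ *ᵥ v = 0 := by rw [hv, Matrix.mulVec_sub, hq, sub_self]
  have hzero : ∑ i, (A *ᵥ w) i * v i = 0 := by
    have e : w ⬝ᵥ Aᵀ *ᵥ v = (A *ᵥ w) ⬝ᵥ v := by
      rw [Matrix.dotProduct_mulVec, Matrix.vecMul_transpose]
    rw [hAv, dotProduct_zero] at e
    exact e.symm
  have hvv : c * μ * ‖v‖ ^ 2 ≤ m * C * (b * K₁ + 1 + K) * μ * (μ * ‖v‖) := by
    have e1 : c * μ * ‖v‖ ^ 2 ≤ ∑ i, D i * v i ^ 2 := by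
      calc c * μ * ‖v‖ ^ 2 ≤ c * μ * ∑ i, v i ^ 2 := by gcongr; exact norm_sq_le_sum_sq v
        _ = ∑ i, c * μ * v i ^ 2 := Finset.mul_sum _ _ _
        _ ≤ ∑ i, D i * v i ^ 2 :=
          Finset.sum_le_sum fun i _ => mul_le_mul_of_nonneg_right (h3 i) (sq_nonneg _)
    have e2 : ∑ i, (D i * v i ^ 2 - (A *ᵥ w) i * v i)
        ≤ ∑ _i : Fin m, C * (b * K₁ + 1 + K) * μ * (μ * ‖v‖) := by
      refine Finset.sum_le_sum fun i _ => ?_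
      have f1 : |((A *ᵥ w) i - D i * p i) * v i| ≤ C * (μ * (μ + K * μ)) * ‖v‖ := by
        rw [abs_mul]
        refine mul_le_mul ((h2 i).trans (by gcongr)) (abs_apply_le_norm v i) (abs_nonneg _)
          (by positivity)
      have f2 : |D i * (q i * v i)| ≤ C * μ * (b * (K₁ * μ) * ‖v‖) := by
        rw [abs_mul, abs_mul, abs_of_nonneg ((mul_nonneg hc.le hμ).trans (h3 i))]
        refine mul_le_mul (h4 i) ?_ (by positivity) (by positivity)
        exact mul_le_mul ((abs_apply_le_norm q i).trans hqn') (abs_apply_le_norm v i)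
          (abs_nonneg _) (by positivity)
      have f3 : D i * v i ^ 2 - (A *ᵥ w) i * v i
          = -(((A *ᵥ w) i - D i * p i) * v i) - D i * (q i * v i) := by
        have : v i = p i - q i := rfl
        rw [this]
        ring
      rw [f3]
      have g1 := (abs_le.1 f1).1
      have g2 := (abs_le.1 f2).1
      linarith
    rw [Finset.sum_sub_distrib, hzero, sub_zero] at e2
    simp only [Finset.sum_const, Finset.card_univ, Fintype.card_fin, nsmul_eq_mul] at e2
    linarith
  have hvn : ‖v‖ ≤ K₂ * μ := by
    rcases (norm_nonneg v).eq_or_lt with h0 | hvpos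
    · rw [← h0]
      positivity
    · have e1 : c * ‖v‖ ≤ m * C * (b * K₁ + 1 + K) * μ := by
        refine le_of_mul_le_mul_right ?_ (mul_pos hpos hvpos)
        linarith
      simp only [K₂]
      rw [div_mul_eq_mul_div, le_div_iff₀ hc]
      linarith
  have hpv : ‖p‖ ≤ ‖v‖ + ‖q‖ := by
    have e : p = v + q := by rw [hv]; abel
    calc ‖p‖ = ‖v + q‖ := by rw [← e]
      _ ≤ _ := norm_add_le v q
  linarith

theorem isBigO_dotProduct {ι κ : Type*} [Fintype κ] {l : Filter ι} {f g : ι → κ → ℝ}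
    {u v : ι → ℝ} (hf : f =O[l] u) (hg : g =O[l] v) :
    (fun k => f k ⬝ᵥ g k) =O[l] fun k => u k * v k :=
  (IsBigO.of_bound (Fintype.card κ) (Eventually.of_forall fun k => by
    simpa only [Real.norm_eq_abs, abs_mul, abs_norm] using abs_dotProduct_le (f k) (g k))).trans
    (hf.norm_left.mul hg.norm_left)

theorem tendsto_entry_of_lipschitz {n : ℕ} {M : (Fin n → ℝ) → Matrix (Fin n) (Fin n) ℝ} {K : ℝ}
    (hM : ∀ z z', mnorm (M z - M z') ≤ K * evnorm (z - z')) (zs : Fin n → ℝ) (a b : Fin n) :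
    Tendsto (fun z => M z a b) (𝓝 zs) (𝓝 (M zs a b)) := by
  have h1 : (fun z => M z a b - M zs a b) =O[𝓝 zs] fun z => z - zs := by
    refine IsBigO.of_bound (|K| * n) (Eventually.of_forall fun z => ?_)
    calc |M z a b - M zs a b| ≤ mnorm (M z - M zs) := abs_entry_le_mnorm (M z - M zs) a b
      _ ≤ K * evnorm (z - zs) := hM z zs
      _ ≤ |K| * (n * ‖z - zs‖) := by
          refine mul_le_mul (le_abs_self K) ?_ (evnorm_nonneg _) (abs_nonneg _)
          simpa using evnorm_le_card_mul_norm (z - zs)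
      _ = _ := by ring
  have h2 : Tendsto (fun z : Fin n → ℝ => z - zs) (𝓝 zs) (𝓝 0) := by
    simpa using (tendsto_id (x := 𝓝 zs)).sub_const zs
  simpa using (h1.trans_tendsto h2).add_const (M zs a b)

namespace NLP

variable {n m : ℕ} {P : NLP n m}

theorem exactStep.primal_eq {z dz : Fin n → ℝ} {lam s t dl ds : Fin m → ℝ}
    (h : P.exactStep z lam s t dz dl ds) :
    P.Lzz z lam *ᵥ dz + ∑ i, dl i • P.gradg i z = -P.Lz z lam := by
  ext j
  have := h.1 j
  simpa [Gfull, Matrix.mulVec, dotProduct, mul_comm] using this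

theorem exactStep.slack_eq {z dz : Fin n → ℝ} {lam s t dl ds : Fin m → ℝ}
    (h : P.exactStep z lam s t dz dl ds) (i : Fin m) :
    P.gradg i z ⬝ᵥ dz + ds i = -(P.g i z + s i) :=
  h.2.1 i

end NLP

namespace LocalSetting

variable {n m : ℕ} {P : NLP n m} {zs : Fin n → ℝ} {lh : Fin m → ℝ} {C gam : ℝ}
  {ι : Type*} {l : Filter ι} {z : ι → Fin n → ℝ} {lam s : ι → Fin m → ℝ}

theorem tendsto_Lzz_apply (h : LocalSetting P zs lh C gam l z lam s) (a b : Fin n) :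
    Tendsto (fun k => P.Lzz (z k) (lam k) a b) l (𝓝 (P.Lzz zs lh a b)) := by
  obtain ⟨K, hK⟩ := P.lip_phi
  simp only [NLP.Lzz, Matrix.add_apply, Matrix.sum_apply, Matrix.smul_apply, smul_eq_mul]
  refine ((tendsto_entry_of_lipschitz hK zs a b).comp h.tendsto_z).add
    (tendsto_finsetSum _ fun i _ => (h.tendsto_lam_apply i).mul ?_)
  obtain ⟨K', hK'⟩ := P.lip_g i
  exact (tendsto_entry_of_lipschitz hK' zs a b).comp h.tendsto_z

theorem tendsto_entrySum_Lzz_sub (h : LocalSetting P zs lh C gam l z lam s) :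
    Tendsto (fun k => entrySum (P.Lzz zs lh - P.Lzz (z k) (lam k))) l (𝓝 0) := by
  have h1 : ∀ a b, Tendsto (fun k => |(P.Lzz zs lh - P.Lzz (z k) (lam k)) a b|) l (𝓝 0) := by
    intro a b
    have := ((h.tendsto_Lzz_apply a b).const_sub (P.Lzz zs lh a b)).abs
    simpa using this
  have h2 := tendsto_finsetSum Finset.univ fun a _ =>
    tendsto_finsetSum Finset.univ fun b _ => h1 a b
  simpa [entrySum] using h2

theorem gradg_isBigO_one (h : LocalSetting P zs lh C gam l z lam s) (i : Fin m) :
    (fun k => P.gradg i (z k)) =O[l] fun _ => (1 : ℝ) :=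
  ((P.hess_g i zs).continuousAt.tendsto.comp h.tendsto_z).isBigO_one ℝ

end LocalSetting

/-- A family of local iterates together with the corresponding exact primal-dual steps. -/
structure StepSetting {n m : ℕ} (P : NLP n m) (zs : Fin n → ℝ) (lh : Fin m → ℝ) (C gam Kt : ℝ)
    {ι : Type*} (l : Filter ι) (z : ι → Fin n → ℝ) (lam s t : ι → Fin m → ℝ)
    (dz : ι → Fin n → ℝ) (dl ds : ι → Fin m → ℝ) : Prop
    extends LocalSetting P zs lh C gam l z lam s where
  soc : P.SOC zs
  strict : P.StrictComp zs
  correction : ∀ᶠ k in l, evnorm (t k) ≤ Kt * dmu (lam k) (s k) ^ 2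
  step : ∀ᶠ k in l, P.exactStep (z k) (lam k) (s k) (t k) (dz k) (dl k) (ds k)

namespace StepSetting

variable {n m : ℕ} {P : NLP n m} {zs : Fin n → ℝ} {lh : Fin m → ℝ} {C gam Kt : ℝ}
  {ι : Type*} {l : Filter ι} {z : ι → Fin n → ℝ} {lam s t : ι → Fin m → ℝ}
  {dz : ι → Fin n → ℝ} {dl ds : ι → Fin m → ℝ}

theorem correction_isBigO (h : StepSetting P zs lh C gam Kt l z lam s t dz dl ds) (i : Fin m) :
    (fun k => t k i) =O[l] fun k => dmu (lam k) (s k) ^ 2 := by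
  refine IsBigO.of_bound Kt ?_
  filter_upwards [h.correction] with k hk
  rw [Real.norm_of_nonneg (sq_nonneg _)]
  exact (abs_le_evnorm (t k) i).trans hk

theorem mu_isBigO_add (h : StepSetting P zs lh C gam Kt l z lam s t dz dl ds) :
    (fun k => dmu (lam k) (s k))
      =O[l] fun k => dmu (lam k) (s k) + ‖dz k + (z k - zs)‖ := by
  refine IsBigO.of_bound 1 ?_
  filter_upwards [h.mu_nonneg] with k hk
  rw [Real.norm_of_nonneg hk, Real.norm_of_nonneg (by positivity), one_mul]
  exact le_add_of_nonneg_right (norm_nonneg _)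

theorem dz_isBigO (h : StepSetting P zs lh C gam Kt l z lam s t dz dl ds) :
    dz =O[l] fun k => dmu (lam k) (s k) + ‖dz k + (z k - zs)‖ := by
  have h1 : (fun k => dz k + (z k - zs))
      =O[l] fun k => dmu (lam k) (s k) + ‖dz k + (z k - zs)‖ := by
    refine IsBigO.of_bound 1 ?_
    filter_upwards [h.mu_nonneg] with k hk
    rw [Real.norm_of_nonneg (by positivity), one_mul]
    exact le_add_of_nonneg_left hk
  have h2 := h1.sub ((h.sub_isBigO h.soc h.strict).trans h.mu_isBigO_add)
  exact h2.congr_left fun k => by abel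

theorem ds_isBigO (h : StepSetting P zs lh C gam Kt l z lam s t dz dl ds) (i : Fin m) :
    (fun k => ds k i) =O[l] fun k => dmu (lam k) (s k) + ‖dz k + (z k - zs)‖ := by
  have h1 := isBigO_dotProduct (h.gradg_isBigO_one i) h.dz_isBigO
  simp only [one_mul] at h1
  have h2 := (((h.slack_isBigO i).trans h.mu_isBigO_add).neg_left).sub h1
  refine h2.congr' ?_ EventuallyEq.rfl
  filter_upwards [h.step] with k hk
  linarith [hk.slack_eq i]

theorem mu_isBigO_one (h : StepSetting P zs lh C gam Kt l z lam s t dz dl ds) :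
    (fun k => dmu (lam k) (s k)) =O[l] fun _ => (1 : ℝ) :=
  h.tendsto_mu.isBigO_one ℝ

theorem dl_inactive_isBigO (h : StepSetting P zs lh C gam Kt l z lam s t dz dl ds) {i : Fin m}
    (hi : P.g i zs ≠ 0) :
    (fun k => dl k i)
      =O[l] fun k => dmu (lam k) (s k) * (1 + ‖dz k + (z k - zs)‖) := by
  have e0 : (fun _ : ι => (1 : ℝ)) =O[l] fun k => 1 + ‖dz k + (z k - zs)‖ :=
    IsBigO.of_bound 1 (Eventually.of_forall fun k => by
      rw [Real.norm_of_nonneg (by positivity), Real.norm_of_nonneg (by positivity)]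
      linarith [norm_nonneg (dz k + (z k - zs))])
  have e1 : (fun k => ‖dz k + (z k - zs)‖) =O[l] fun k => 1 + ‖dz k + (z k - zs)‖ :=
    IsBigO.of_bound 1 (Eventually.of_forall fun k => by
      rw [Real.norm_of_nonneg (by positivity), Real.norm_of_nonneg (by positivity)]
      linarith)
  have e2 : (fun k => dmu (lam k) (s k) + ‖dz k + (z k - zs)‖)
      =O[l] fun k => 1 + ‖dz k + (z k - zs)‖ :=
    (h.mu_isBigO_one.trans e0).add e1
  have e3 : (fun k => dmu (lam k) (s k))
      =O[l] fun k => dmu (lam k) (s k) * (1 + ‖dz k + (z k - zs)‖) := by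
    simpa using (isBigO_refl (fun k => dmu (lam k) (s k)) l).mul e0
  have h1 : (fun k => s k i * lam k i) =O[l] fun k => dmu (lam k) (s k) := by
    simpa using ((h.tendsto_slack i).isBigO_one ℝ).mul (h.lam_inactive_isBigO hi)
  have h2 : (fun k => t k i) =O[l] fun k => dmu (lam k) (s k) := by
    have := (isBigO_refl (fun k => dmu (lam k) (s k)) l).mul h.mu_isBigO_one
    simp only [mul_one, ← pow_two] at this
    exact (h.correction_isBigO i).trans this
  have h3 := (h.lam_inactive_isBigO hi).mul ((h.ds_isBigO i).trans e2)
  have h4 := (((h1.add h2).neg_left).trans e3).sub h3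
  obtain ⟨c, hc, hs⟩ := h.slack_inactive_ge hi
  have h5 : (fun k => (s k i)⁻¹) =O[l] fun _ => (1 : ℝ) := by
    refine ((h.tendsto_slack i).inv₀ (neg_ne_zero.2 hi)).isBigO_one ℝ
  have h6 := h5.mul h4
  simp only [one_mul] at h6
  refine h6.congr' ?_ EventuallyEq.rfl
  filter_upwards [h.step, hs] with k hk hsk
  have h7 : s k i ≠ 0 := (hc.trans_le hsk).ne'
  have h8 := hk.2.2 i
  field_simp
  linarith

theorem inv_lam_isBigO_one (h : StepSetting P zs lh C gam Kt l z lam s t dz dl ds) {i : Fin m}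
    (hi : P.g i zs = 0) : (fun k => (lam k i)⁻¹) =O[l] fun _ => (1 : ℝ) := by
  obtain ⟨c, hc, hl⟩ := h.lam_active_ge h.soc h.strict hi
  refine IsBigO.of_bound c⁻¹ ?_
  filter_upwards [hl] with k hk
  rw [norm_one, mul_one, Real.norm_of_nonneg (inv_nonneg.2 (hc.le.trans hk))]
  exact inv_anti₀ hc hk

theorem active_residual_isBigO (h : StepSetting P zs lh C gam Kt l z lam s t dz dl ds) {i : Fin m}
    (hi : P.g i zs = 0) :
    (fun k => P.gradg i zs ⬝ᵥ (dz k + (z k - zs)) - s k i / lam k i * dl k i)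
      =O[l] fun k => dmu (lam k) (s k) * (dmu (lam k) (s k) + ‖dz k + (z k - zs)‖) := by
  have hd := h.sub_isBigO h.soc h.strict
  have e1 := (isBigO_refl (fun k => dmu (lam k) (s k)) l).mul h.mu_isBigO_add
  have h1 := ((h.constraint_linearization i).trans ((hd.norm_left.pow 2).trans
    (by simpa only [pow_two] using e1)))
  have h2 := isBigO_dotProduct
    (((P.gradg_sub_isBigO i zs).comp_tendsto h.tendsto_z).trans hd) h.dz_isBigO
  have h3 := ((h.correction_isBigO i).mul (h.inv_lam_isBigO_one hi)).trans
    (by simpa only [pow_two, mul_one] using e1)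
  have h4 := (h1.neg_left.sub h2).add h3
  refine h4.congr' ?_ EventuallyEq.rfl
  filter_upwards [h.step, h.central] with k hk hck
  have h5 : lam k i ≠ 0 := (hck.2.2.1 i).ne'
  have h6 := hk.2.2 i
  have h7 := hk.slack_eq i
  have h8 : s k i / lam k i * dl k i = -ds k i - s k i - t k i * (lam k i)⁻¹ := by
    field_simp
    linarith
  rw [h8, dotProduct_add]
  simp only [Function.comp, sub_dotProduct, hi]
  linarith

end StepSetting

namespace StepSetting

variable {n m : ℕ} {P : NLP n m} {zs : Fin n → ℝ} {lh : Fin m → ℝ} {C gam Kt : ℝ}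
  {ι : Type*} {l : Filter ι} {z : ι → Fin n → ℝ} {lam s t : ι → Fin m → ℝ}
  {dz : ι → Fin n → ℝ} {dl ds : ι → Fin m → ℝ}

/-- The part of a dual step belonging to the active constraints. -/
def activePart {n m : ℕ} (P : NLP n m) (zs : Fin n → ℝ) (p : Fin m → ℝ) : Fin m → ℝ :=
  fun i => if P.g i zs = 0 then p i else 0

theorem dual_residual_le (h : StepSetting P zs lh C gam Kt l z lam s t dz dl ds) :
    ∃ B : ℝ, 0 < B ∧ ∀ δ > 0, ∀ᶠ k in l,
      ‖P.Lzz zs lh *ᵥ (dz k + (z k - zs)) + (P.activeJac zs)ᵀ *ᵥ activePart P zs (dl k)‖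
        ≤ B * dmu (lam k) (s k) + δ * ‖dz k + (z k - zs)‖
          + B * (dmu (lam k) (s k) * ‖activePart P zs (dl k)‖) := by
  have hd := h.sub_isBigO h.soc h.strict
  obtain ⟨a, ha, hA⟩ := (((h.Lz_isBigO).neg_left.add
    ((IsBigO.of_bound (entrySum (P.Lzz zs lh)) (Eventually.of_forall fun k =>
      norm_mulVec_le (P.Lzz zs lh) (z k - zs))).trans hd))).exists_pos
  have hB : (fun k => ∑ i, (if P.g i zs = 0 then 0 else dl k i) • P.gradg i (z k))
      =O[l] fun k => dmu (lam k) (s k) * (1 + ‖dz k + (z k - zs)‖) := by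
    refine IsBigO.fun_sum fun i _ => ?_
    by_cases hi : P.g i zs = 0
    · simpa only [if_pos hi, zero_smul] using isBigO_zero _ l
    · simpa only [if_neg hi, smul_eq_mul, mul_one] using
        (h.dl_inactive_isBigO hi).smul (h.gradg_isBigO_one i)
  obtain ⟨b, hb, hB⟩ := hB.exists_pos
  obtain ⟨c, hc, hDz⟩ := h.dz_isBigO.exists_pos
  have hE : (fun k => ∑ i, activePart P zs (dl k) i • (P.gradg i zs - P.gradg i (z k)))
      =O[l] fun k => dmu (lam k) (s k) * ‖activePart P zs (dl k)‖ := by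
    refine IsBigO.fun_sum fun i _ => ?_
    have h1 : (fun k => activePart P zs (dl k) i) =O[l] fun k => ‖activePart P zs (dl k)‖ :=
      IsBigO.of_bound 1 (Eventually.of_forall fun k => by
        rw [one_mul, norm_norm]
        exact norm_le_pi_norm _ i)
    have h2 := (((P.gradg_sub_isBigO i zs).comp_tendsto h.tendsto_z).trans hd).neg_left
    simpa only [Function.comp, neg_sub, smul_eq_mul, mul_comm] using h1.smul h2
  obtain ⟨e, he, hE⟩ := hE.exists_pos
  refine ⟨a + b + 1 + e, by positivity, fun δ hδ => ?_⟩
  have hsmall := h.tendsto_mu.eventually_le_const (show (0 : ℝ) < δ / (2 * b) by positivity)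
  have hsmall' := h.tendsto_entrySum_Lzz_sub.eventually_le_const
    (show (0 : ℝ) < min 1 (δ / 2) / c by positivity)
  filter_upwards [hA.bound, hB.bound, hDz.bound, hE.bound, hsmall, hsmall', h.mu_nonneg, h.step]
    with k kA kB kD kE k1 k2 hmu hk
  set μ := dmu (lam k) (s k)
  set w := dz k + (z k - zs) with hw
  set p := activePart P zs (dl k) with hp
  have hW := norm_nonneg w
  rw [Real.norm_of_nonneg (by positivity)] at kA kB kD kE
  have hsplit : P.Lzz zs lh *ᵥ w + (P.activeJac zs)ᵀ *ᵥ p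
      = (-P.Lz (z k) (lam k) + P.Lzz zs lh *ᵥ (z k - zs))
        - ∑ i, (if P.g i zs = 0 then 0 else dl k i) • P.gradg i (z k)
        + (P.Lzz zs lh - P.Lzz (z k) (lam k)) *ᵥ dz k
        + ∑ i, p i • (P.gradg i zs - P.gradg i (z k)) := by
    have e1 : ∑ i, dl k i • P.gradg i (z k)
        = ∑ i, (if P.g i zs = 0 then 0 else dl k i) • P.gradg i (z k)
          + ∑ i, p i • P.gradg i (z k) := by
      rw [← Finset.sum_add_distrib]
      refine Finset.sum_congr rfl fun i _ => ?_
      by_cases hi : P.g i zs = 0 <;> simp [hp, activePart, hi]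
    have e2 : (P.activeJac zs)ᵀ *ᵥ p = ∑ i, p i • P.gradg i zs := by
      rw [NLP.activeJac_transpose_mulVec]
      refine Finset.sum_congr rfl fun i _ => ?_
      by_cases hi : P.g i zs = 0 <;> simp [hp, activePart, hi]
    have e3 := hk.primal_eq
    rw [e1] at e3
    rw [← e3, e2, hw]
    simp only [Matrix.mulVec_add, Matrix.sub_mulVec, smul_sub, Finset.sum_sub_distrib]
    abel
  have hM : ‖(P.Lzz zs lh - P.Lzz (z k) (lam k)) *ᵥ dz k‖ ≤ μ + δ / 2 * ‖w‖ := by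
    calc _ ≤ entrySum (P.Lzz zs lh - P.Lzz (z k) (lam k)) * ‖dz k‖ := norm_mulVec_le _ _
      _ ≤ min 1 (δ / 2) / c * (c * (μ + ‖w‖)) := by gcongr
      _ = min 1 (δ / 2) * μ + min 1 (δ / 2) * ‖w‖ := by field_simp
      _ ≤ 1 * μ + δ / 2 * ‖w‖ := by
          gcongr
          · exact min_le_left _ _
          · exact min_le_right _ _
      _ = _ := by ring
  have hb1 : b * (μ * (1 + ‖w‖)) ≤ b * μ + δ / 2 * ‖w‖ := by
    have : b * μ ≤ δ / 2 := by
      rw [le_div_iff₀ (by positivity)] at k1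
      linarith
    nlinarith
  have r1 : 0 ≤ e * μ := by positivity
  have r2 : 0 ≤ (a + b + 1) * (μ * ‖p‖) := by positivity
  rw [hsplit]
  refine (norm_add_le _ _).trans ((add_le_add_left (norm_add_le _ _) _).trans
    ((add_le_add_left (add_le_add_left (norm_sub_le _ _) _) _).trans ?_))
  linarith

theorem exists_slack_ratio_ge (h : StepSetting P zs lh C gam Kt l z lam s t dz dl ds) :
    ∃ c : ℝ, 0 < c ∧ ∀ᶠ k in l, ∀ i, c * dmu (lam k) (s k) ≤ s k i / lam k i := by
  set L := ‖lh‖ + 1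
  have hL : 0 < L := by positivity
  have hlam := h.tendsto_lam.norm.eventually_le_const (show ‖lh‖ < L from lt_add_one _)
  refine ⟨gam / L ^ 2, div_pos h.gam_pos (by positivity), ?_⟩
  filter_upwards [h.central, h.mu_nonneg, hlam] with k hk hmu hl i
  have h1 := hk.2.2.1 i
  have h2 : lam k i ≤ L := ((le_abs_self _).trans (abs_apply_le_norm (lam k) i)).trans hl
  have h3 := hk.2.2.2.2 i
  have h4 : lam k i ^ 2 ≤ L ^ 2 := pow_le_pow_left₀ h1.le h2 2
  calc gam / L ^ 2 * dmu (lam k) (s k) = gam * dmu (lam k) (s k) / L ^ 2 := by ring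
    _ ≤ gam * dmu (lam k) (s k) / lam k i ^ 2 :=
        div_le_div_of_nonneg_left (mul_nonneg h.gam_pos.le hmu) (by positivity) h4
    _ ≤ lam k i * s k i / lam k i ^ 2 := by gcongr
    _ = s k i / lam k i := by field_simp

theorem primal_and_activePart_isBigO (h : StepSetting P zs lh C gam Kt l z lam s t dz dl ds) :
    (fun k => dz k + (z k - zs)) =O[l] (fun k => dmu (lam k) (s k)) ∧
      (fun k => activePart P zs (dl k)) =O[l] fun k => dmu (lam k) (s k) := by
  obtain ⟨ξ₀, hξ₀, hH⟩ := h.soc.quadForm_ge h.strict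
  obtain ⟨ξ, κ, hξ, hκ, hq⟩ := exists_quadForm_lower_bound (P.Lzz zs lh) (P.activeJac zs) hξ₀
    (hH lh h.multiplier)
  set D : ι → Fin m → ℝ := fun k i =>
    if P.g i zs = 0 then s k i / lam k i else dmu (lam k) (s k) with hD
  have hDO : D =O[l] fun k => dmu (lam k) (s k) := by
    refine isBigO_pi.2 fun i => ?_
    by_cases hi : P.g i zs = 0
    · have := ((h.norm_sq_isBigO_and_slack_isBigO h.soc h.strict).2 i hi).mul
        (h.inv_lam_isBigO_one hi)
      simpa only [hD, if_pos hi, div_eq_mul_inv, mul_one] using this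
    · simpa only [hD, if_neg hi] using isBigO_refl (fun k => dmu (lam k) (s k)) l
  have hRO : (fun k i => (P.activeJac zs *ᵥ (dz k + (z k - zs))) i
      - D k i * activePart P zs (dl k) i)
      =O[l] fun k => dmu (lam k) (s k) * (dmu (lam k) (s k) + ‖dz k + (z k - zs)‖) := by
    refine isBigO_pi.2 fun i => ?_
    by_cases hi : P.g i zs = 0
    · simpa only [hD, activePart, NLP.activeJac_mulVec, if_pos hi] using
        h.active_residual_isBigO hi
    · simpa only [hD, activePart, NLP.activeJac_mulVec, if_neg hi, mul_zero, sub_zero] using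
        isBigO_zero _ l
  obtain ⟨C₁, hC₁, hD₁⟩ := hDO.exists_pos
  obtain ⟨C₂, hC₂, hR₂⟩ := hRO.exists_pos
  obtain ⟨B, hB, hres⟩ := h.dual_residual_le
  obtain ⟨c₀, hc₀, hratio⟩ := h.exists_slack_ratio_ge
  have hc : 0 < min c₀ 1 := by positivity
  have hCs : 0 < C₁ + C₂ + B := by positivity
  obtain ⟨K, δ, hK, hδ, hprimal⟩ := saddle_point_bound hξ hκ hq hc hCs
  obtain ⟨M, hM, hdual⟩ := saddle_point_dual_bound (H := P.Lzz zs lh) (A := P.activeJac zs)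
    hc hCs hK hδ
  have key : ∀ᶠ k in l, ‖dz k + (z k - zs)‖ ≤ K * dmu (lam k) (s k) ∧
      ‖activePart P zs (dl k)‖ ≤ M * dmu (lam k) (s k) := by
    have hpos : ∀ᶠ k in l, ∀ _i : Fin m, 0 < dmu (lam k) (s k) :=
      eventually_all.2 fun i => h.mu_pos i
    filter_upwards [hD₁.bound, hR₂.bound, hres δ hδ, hratio, h.mu_nonneg,
      h.tendsto_mu.eventually_le_const hδ, hpos] with k k1 k2 k3 k4 hmu k5 k6
    rw [Real.norm_of_nonneg hmu] at k1
    rw [Real.norm_of_nonneg (by positivity)] at k2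
    set μ := dmu (lam k) (s k) with hμ
    set w := dz k + (z k - zs)
    set p := activePart P zs (dl k)
    have g1 : ‖P.Lzz zs lh *ᵥ w + (P.activeJac zs)ᵀ *ᵥ p‖
        ≤ (C₁ + C₂ + B) * μ + δ * ‖w‖ + (C₁ + C₂ + B) * (μ * ‖p‖) := by
      refine k3.trans ?_
      gcongr <;> linarith
    have g2 : ∀ i, |(P.activeJac zs *ᵥ w) i - D k i * p i|
        ≤ (C₁ + C₂ + B) * (μ * (μ + ‖w‖)) := fun i => by
      refine ((abs_apply_le_norm (fun i => (P.activeJac zs *ᵥ w) i - D k i * p i) i).trans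
        k2).trans ?_
      gcongr
      linarith
    have g3 : ∀ i, min c₀ 1 * μ ≤ D k i := fun i => by
      by_cases hi : P.g i zs = 0
      · simp only [hD, if_pos hi]
        exact (mul_le_mul_of_nonneg_right (min_le_left _ _) hmu).trans (k4 i)
      · simp only [hD, if_neg hi]
        exact (mul_le_mul_of_nonneg_right (min_le_right _ _) hmu).trans (one_mul μ).le
    have g4 : ∀ i, D k i ≤ (C₁ + C₂ + B) * μ := fun i => by
      refine ((le_abs_self _).trans (abs_apply_le_norm (D k) i)).trans (k1.trans ?_)
      gcongr
      linarith
    have g5 : μ = 0 → p = 0 := fun h0 => funext fun i => absurd h0 (k6 i).ne'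
    obtain ⟨q1, q2⟩ := hprimal μ w p (D k) hmu k5 g1 g2 g3 g4 g5
    exact ⟨q1, hdual μ w p (D k) hmu g1 g2 g3 g4 g5 q1 q2⟩
  constructor
  · refine IsBigO.of_bound K ?_
    filter_upwards [key, h.mu_nonneg] with k hk hmu
    rw [Real.norm_of_nonneg hmu]
    exact hk.1
  · refine IsBigO.of_bound M ?_
    filter_upwards [key, h.mu_nonneg] with k hk hmu
    rw [Real.norm_of_nonneg hmu]
    exact hk.2

/-- The full primal-dual step is of the order of the duality measure. -/
theorem exists_step_le (h : StepSetting P zs lh C gam Kt l z lam s t dz dl ds) :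
    ∃ K : ℝ, 0 < K ∧ ∀ᶠ k in l,
      √(evnorm (dz k) ^ 2 + evnorm (dl k) ^ 2 + evnorm (ds k) ^ 2) ≤ K * dmu (lam k) (s k) := by
  obtain ⟨hw, hp⟩ := h.primal_and_activePart_isBigO
  have hsum : (fun k => dmu (lam k) (s k) + ‖dz k + (z k - zs)‖)
      =O[l] fun k => dmu (lam k) (s k) := (isBigO_refl _ l).add hw.norm_left
  have hdz := h.dz_isBigO.trans hsum
  have hds : ds =O[l] fun k => dmu (lam k) (s k) :=
    isBigO_pi.2 fun i => (h.ds_isBigO i).trans hsum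
  have hdl : dl =O[l] fun k => dmu (lam k) (s k) := by
    refine isBigO_pi.2 fun i => ?_
    by_cases hi : P.g i zs = 0
    · simpa only [activePart, if_pos hi] using isBigO_pi.1 hp i
    · have h1 : (fun k => 1 + ‖dz k + (z k - zs)‖) =O[l] fun _ => (1 : ℝ) :=
        (isBigO_refl _ l).add (hw.norm_left.trans h.mu_isBigO_one)
      have h2 := (isBigO_refl (fun k => dmu (lam k) (s k)) l).mul h1
      simp only [mul_one] at h2
      exact (h.dl_inactive_isBigO hi).trans h2
  obtain ⟨a, ha, hA⟩ := hdz.exists_pos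
  obtain ⟨b, hb, hB⟩ := hdl.exists_pos
  obtain ⟨c, hc, hC⟩ := hds.exists_pos
  refine ⟨n * a + m * b + m * c + 1, by positivity, ?_⟩
  filter_upwards [hA.bound, hB.bound, hC.bound, h.mu_nonneg] with k k1 k2 k3 hmu
  rw [Real.norm_of_nonneg hmu] at k1 k2 k3
  have e1 : evnorm (dz k) ≤ n * (a * dmu (lam k) (s k)) := by
    refine (evnorm_le_card_mul_norm (dz k)).trans ?_
    rw [Fintype.card_fin]
    gcongr
  have e2 : evnorm (dl k) ≤ m * (b * dmu (lam k) (s k)) := by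
    refine (evnorm_le_card_mul_norm (dl k)).trans ?_
    rw [Fintype.card_fin]
    gcongr
  have e3 : evnorm (ds k) ≤ m * (c * dmu (lam k) (s k)) := by
    refine (evnorm_le_card_mul_norm (ds k)).trans ?_
    rw [Fintype.card_fin]
    gcongr
  have n1 := evnorm_nonneg (dz k)
  have n2 := evnorm_nonneg (dl k)
  have n3 := evnorm_nonneg (ds k)
  have n12 := mul_nonneg n1 n2
  have n13 := mul_nonneg n1 n3
  have n23 := mul_nonneg n2 n3
  have e4 : √(evnorm (dz k) ^ 2 + evnorm (dl k) ^ 2 + evnorm (ds k) ^ 2)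
      ≤ evnorm (dz k) + evnorm (dl k) + evnorm (ds k) :=
    Real.sqrt_le_iff.2 ⟨by positivity, by nlinarith⟩
  linarith

end StepSetting

theorem NLP.isCompact_Slam {n m : ℕ} {P : NLP n m} {zs : Fin n → ℝ} (hmfcq : P.MFCQ zs) :
    IsCompact (P.Slam zs) := by
  obtain ⟨y, hy⟩ := hmfcq
  set G : ℝ := P.gradphi zs ⬝ᵥ y with hG
  set R : Fin m → ℝ := fun i => if P.g i zs = 0 then G / -(P.gradg i zs ⬝ᵥ y) else 0 with hR
  refine isCompact_Icc.of_isClosed_subset (s := Set.Icc 0 R) ?_ fun ls hls => ?_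
  · have h1 : IsClosed {ls : Fin m → ℝ | P.Lz zs ls = 0} := by
      refine isClosed_eq ?_ continuous_const
      unfold NLP.Lz
      fun_prop
    have h2 : IsClosed {ls : Fin m → ℝ | ∀ i, 0 ≤ ls i} := by
      simp only [Set.ofPred_forall]
      exact isClosed_iInter fun i => isClosed_le continuous_const (continuous_apply i)
    have h3 : IsClosed {ls : Fin m → ℝ | ∑ i, ls i * P.g i zs = 0} :=
      isClosed_eq (by fun_prop) continuous_const
    exact h1.inter (isClosed_const.inter (h2.inter h3))
  · refine ⟨fun i => hls.2.2.1 i, fun i => ?_⟩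
    by_cases hi : P.g i zs = 0
    · have hpos : 0 < -(P.gradg i zs ⬝ᵥ y) := neg_pos.2 (hy i hi)
      simp only [hR, if_pos hi]
      rw [le_div_iff₀ hpos]
      have e : G + ∑ j, ls j * (P.gradg j zs ⬝ᵥ y) = 0 := by
        have := congrArg (· ⬝ᵥ y) hls.1
        simpa [NLP.Lz_eq, add_dotProduct, sum_dotProduct, smul_dotProduct] using this
      have e2 : ls i * -(P.gradg i zs ⬝ᵥ y) ≤ ∑ j, ls j * -(P.gradg j zs ⬝ᵥ y) := by
        refine Finset.single_le_sum (f := fun j => ls j * -(P.gradg j zs ⬝ᵥ y)) (fun j _ => ?_)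
          (Finset.mem_univ i)
        by_cases hj : P.g j zs = 0
        · exact mul_nonneg (hls.2.2.1 j) (neg_pos.2 (hy j hj)).le
        · rw [NLP.KKT.multiplier_eq_zero hls hj, zero_mul]
      simp only [mul_neg, Finset.sum_neg_distrib] at e2 ⊢
      linarith
    · rw [NLP.KKT.multiplier_eq_zero hls hi]
      simp [hR, hi]

/-- The step bound on a neighbourhood of the primal-dual solutions with multipliers in `A`. -/
def StepBoundNear {n m : ℕ} (P : NLP n m) (zs : Fin n → ℝ) (C gam Kt : ℝ)
    (A : Set (Fin m → ℝ)) : Prop :=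
  ∃ K : ℝ, 0 < K ∧ ∃ mubar : ℝ, 0 < mubar ∧ ∃ W : Set ((Fin n → ℝ) × (Fin m → ℝ)), IsOpen W ∧
    (∀ ls ∈ A, (zs, ls) ∈ W) ∧
    ∀ z : Fin n → ℝ, ∀ lam s t : Fin m → ℝ, ∀ dz : Fin n → ℝ, ∀ dl ds : Fin m → ℝ,
      (z, lam) ∈ W → P.central C gam z lam s → dmu lam s ≤ mubar →
      evnorm t ≤ Kt * dmu lam s ^ 2 → P.exactStep z lam s t dz dl ds →
      √(evnorm dz ^ 2 + evnorm dl ^ 2 + evnorm ds ^ 2) ≤ K * dmu lam s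

namespace StepBoundNear

variable {n m : ℕ} {P : NLP n m} {zs : Fin n → ℝ} {C gam Kt : ℝ} {A A' : Set (Fin m → ℝ)}

theorem empty : StepBoundNear P zs C gam Kt ∅ :=
  ⟨1, one_pos, 1, one_pos, ∅, isOpen_empty, fun _ h => h.elim, fun _ _ _ _ _ _ _ h => h.elim⟩

theorem mono (hA : A ⊆ A') (h : StepBoundNear P zs C gam Kt A') :
    StepBoundNear P zs C gam Kt A := by
  obtain ⟨K, hK, mb, hmb, W, hW, hmem, hle⟩ := h
  exact ⟨K, hK, mb, hmb, W, hW, fun ls hls => hmem ls (hA hls), hle⟩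

theorem union (h : StepBoundNear P zs C gam Kt A) (h' : StepBoundNear P zs C gam Kt A') :
    StepBoundNear P zs C gam Kt (A ∪ A') := by
  obtain ⟨K, hK, mb, hmb, W, hW, hmem, hle⟩ := h
  obtain ⟨K', -, mb', hmb', W', hW', hmem', hle'⟩ := h'
  refine ⟨max K K', lt_max_of_lt_left hK, min mb mb', lt_min hmb hmb', W ∪ W', hW.union hW',
    fun ls hls => hls.imp (hmem ls) (hmem' ls), fun z lam s t dz dl ds hzl hc hmu ht hstep => ?_⟩
  have hmu0 := hc.mu_nonneg
  rcases hzl with hzl | hzl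
  · exact (hle z lam s t dz dl ds hzl hc (hmu.trans (min_le_left _ _)) ht hstep).trans
      (mul_le_mul_of_nonneg_right (le_max_left _ _) hmu0)
  · exact (hle' z lam s t dz dl ds hzl hc (hmu.trans (min_le_right _ _)) ht hstep).trans
      (mul_le_mul_of_nonneg_right (le_max_right _ _) hmu0)

theorem exists_nhds (hsoc : P.SOC zs) (hsc : P.StrictComp zs) (hC : 0 < C) (hgam : 0 < gam)
    {lh : Fin m → ℝ} (hlh : lh ∈ P.Slam zs) :
    ∃ U ∈ 𝓝 lh, StepBoundNear P zs C gam Kt U := by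
  let T := ((Fin n → ℝ) × (Fin m → ℝ)) × (Fin m → ℝ) × (Fin m → ℝ) × (Fin n → ℝ)
    × (Fin m → ℝ) × (Fin m → ℝ)
  let good : Set T := {x | P.central C gam x.1.1 x.1.2 x.2.1 ∧
    evnorm x.2.2.1 ≤ Kt * dmu x.1.2 x.2.1 ^ 2 ∧
    P.exactStep x.1.1 x.1.2 x.2.1 x.2.2.1 x.2.2.2.1 x.2.2.2.2.1 x.2.2.2.2.2}
  let F : Filter (((Fin n → ℝ) × (Fin m → ℝ)) × ℝ) := 𝓝 (zs, lh) ×ˢ 𝓝 0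
  let π : T → ((Fin n → ℝ) × (Fin m → ℝ)) × ℝ := fun x => (x.1, dmu x.1.2 x.2.1)
  let l : Filter T := comap π F ⊓ 𝓟 good
  have hπ : Tendsto π l F := tendsto_comap.mono_left inf_le_left
  have hgood : ∀ᶠ x in l, x ∈ good := mem_inf_of_right (mem_principal_self good)
  have hzl : Tendsto (fun x : T => x.1) l (𝓝 (zs, lh)) :=
    (tendsto_fst (f := 𝓝 (zs, lh)) (g := 𝓝 (0 : ℝ))).comp hπ
  have hS : StepSetting P zs lh C gam Kt l (fun x => x.1.1) (fun x => x.1.2) (fun x => x.2.1)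
      (fun x => x.2.2.1) (fun x => x.2.2.2.1) (fun x => x.2.2.2.2.1) (fun x => x.2.2.2.2.2) :=
    { multiplier := hlh
      C_pos := hC
      gam_pos := hgam
      tendsto_z := (continuous_fst.tendsto (zs, lh)).comp hzl
      tendsto_lam := (continuous_snd.tendsto (zs, lh)).comp hzl
      tendsto_mu := (tendsto_snd (f := 𝓝 (zs, lh)) (g := 𝓝 (0 : ℝ))).comp hπ
      central := hgood.mono fun x hx => hx.1
      soc := hsoc
      strict := hsc
      correction := hgood.mono fun x hx => hx.2.1
      step := hgood.mono fun x hx => hx.2.2 }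
  obtain ⟨K, hK, hev⟩ := hS.exists_step_le
  obtain ⟨V, hV, hVsub⟩ := mem_comap.1 (mem_inf_principal.1 hev)
  obtain ⟨W₀, hW₀, M, hM, hWM⟩ := mem_prod_iff.1 hV
  obtain ⟨W, hWW, hW, hmem⟩ := mem_nhds_iff.1 hW₀
  obtain ⟨ε, hε, hball⟩ := Metric.mem_nhds_iff.1 hM
  refine ⟨(fun ls => (zs, ls)) ⁻¹' W,
    (hW.preimage (by fun_prop)).mem_nhds hmem, K, hK, ε / 2, half_pos hε, W, hW,
    fun ls hls => hls, fun z lam s t dz dl ds hzl hc hmu ht hstep => ?_⟩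
  have hmu0 := hc.mu_nonneg
  have h1 : dmu lam s ∈ M := hball (by
    rw [Metric.mem_ball, dist_zero_right, Real.norm_of_nonneg hmu0]
    linarith)
  exact hVsub (a := ((z, lam), s, t, dz, dl, ds)) (hWM ⟨hWW hzl, h1⟩) ⟨hc, ht, hstep⟩

end StepBoundNear

end

/-- **size of the exact step.** Suppose `z*` is a solution at which
MFCQ, the second-order condition and strict complementarity are satisfied, fix
centrality constants `C > 0`, `γ ∈ (0,1)`, and suppose the correction vector
satisfies `‖t‖ ≤ K_t μ²`.  Then there exist `K > 0`, `μ̄ > 0` and a neighborhood `W`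
of `S` such that for every iterate `(z,λ,s)` satisfying the approximate centrality
conditions with `(z,λ) ∈ W` and `μ = λᵀs/m ≤ μ̄`, the exact primal–dual step
satisfies `‖(Δz, Δλ, Δs)‖ ≤ K·μ`. -/
theorem stmt7_exact_step_O_mu
    {n m : ℕ} (P : NLP n m) (zstar : Fin n → ℝ)
    (hsol : P.isSolution zstar)
    (hmfcq : P.MFCQ zstar)
    (hsoc : P.SOC zstar)
    (hsc : P.StrictComp zstar)
    (C gam Kt : ℝ) (hC : 0 < C) (hgam0 : 0 < gam) (hgam1 : gam < 1) (hKt : 0 < Kt) :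
    ∃ K : ℝ, 0 < K ∧
      ∃ mubar : ℝ, 0 < mubar ∧
        ∃ W : Set ((Fin n → ℝ) × (Fin m → ℝ)), IsOpen W ∧
          (∀ ls ∈ P.Slam zstar, (zstar, ls) ∈ W) ∧
          ∀ z : Fin n → ℝ, ∀ lam s t : Fin m → ℝ,
            ∀ dz : Fin n → ℝ, ∀ dl ds : Fin m → ℝ,
            (z, lam) ∈ W → P.central C gam z lam s → dmu lam s ≤ mubar →
            evnorm t ≤ Kt * dmu lam s ^ 2 →
            P.exactStep z lam s t dz dl ds →
            Real.sqrt (evnorm dz ^ 2 + evnorm dl ^ 2 + evnorm ds ^ 2) ≤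
              K * dmu lam s := by
  refine (NLP.isCompact_Slam hmfcq).induction_on (p := StepBoundNear P zstar C gam Kt)
    StepBoundNear.empty (fun _ _ hA h => h.mono hA) (fun _ _ h h' => h.union h') fun _ hls => ?_
  obtain ⟨U, hU, h⟩ := StepBoundNear.exists_nhds hsoc hsc hC hgam0 hls
  exact ⟨U, mem_nhdsWithin_of_mem_nhds hU, h⟩
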